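/- Let g : (ℂⁿ, 0) → (ℂⁿ, 0) be a germ of a finite holomorphic map. Let F be a germ of a codimension one holomorphic foliation that is singular at 0. Then the pullback foliation g*F is singular at 0. -/

import Mathlib

open Set Filter Topology

noncomputable section

/-- `ℂⁿ`, modeled as the space of functions `Fin n → ℂ`. -/
abbrev Cn (n : ℕ) : Type := Fin n → ℂ

/-- A one-form on (a subset of) `ℂⁿ`: a field of continuous `ℂ`-linear functionals. -/
abbrev OneForm (n : ℕ) : Type := Cn n → (Cn n →L[ℂ] ℂ)

/-- The exterior derivative `dω` of a one-form, evaluated at `x` on vectors `u, v`. -/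
def extd {n : ℕ} (ω : OneForm n) (x u v : Cn n) : ℂ :=
  fderiv ℂ ω x u v - fderiv ℂ ω x v u

/-- The integrability condition `ω ∧ dω = 0` on `U`, written out on triples of vectors. -/
def FormIntegrableOn {n : ℕ} (ω : OneForm n) (U : Set (Cn n)) : Prop :=
  ∀ x ∈ U, ∀ u v w : Cn n,
    ω x u * extd ω x v w + ω x v * extd ω x w u + ω x w * extd ω x u v = 0

/-- `Z` has codimension at least two: it contains no nonempty local analytic
hypersurface (the zero set of a holomorphic function, not identically zero, on a
connected open set). -/
def CodimAtLeastTwo {n : ℕ} (Z : Set (Cn n)) : Prop :=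
  ¬ ∃ (q : Cn n) (V : Set (Cn n)) (ψ : Cn n → ℂ), IsOpen V ∧ IsPreconnected V ∧ q ∈ V ∧
      AnalyticOnNhd ℂ ψ V ∧ ψ q = 0 ∧ (∃ x ∈ V, ψ x ≠ 0) ∧ {x ∈ V | ψ x = 0} ⊆ Z

/-- `ω` defines a singular codimension-one holomorphic foliation on the open set `W`:
it is holomorphic, integrable (`ω ∧ dω = 0`), and its zero set has codimension `≥ 2`.
The foliation is singular at a point `x ∈ W` iff `ω x = 0`. -/
structure IsFoliationOn {n : ℕ} (ω : OneForm n) (W : Set (Cn n)) : Prop where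
  isOpen : IsOpen W
  holo : AnalyticOnNhd ℂ ω W
  integrable : FormIntegrableOn ω W
  codim : CodimAtLeastTwo {x ∈ W | ω x = 0}

section ResidueTrace

open MeasureTheory ComplexConjugate

section Jacobian

variable {ι : Type*} [Fintype ι]

lemma AnalyticAt.fderiv_apply_apply {E : Type*} [NormedAddCommGroup E] [NormedSpace ℂ E]
    {g : E → (ι → ℂ)} {x : E} (hg : AnalyticAt ℂ g x) (v : E) (i : ι) :
    AnalyticAt ℂ (fun y => fderiv ℂ g y v i) x :=
  ((ContinuousLinearMap.proj (R := ℂ) (φ := fun _ : ι => ℂ) i).comp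
    (ContinuousLinearMap.apply ℂ (ι → ℂ) v)).analyticAt _ |>.comp hg.fderiv

variable [DecidableEq ι]

/-- The transposed Jacobian matrix of `g` at `x`: the entry `(k, i)` is `∂ₖ gᵢ (x)`. -/
def jacobian (g : (ι → ℂ) → (ι → ℂ)) (x : ι → ℂ) : Matrix ι ι ℂ :=
  Matrix.of fun k i => fderiv ℂ g x (Pi.single k 1) i

lemma AnalyticAt.matrix_det {E : Type*} [NormedAddCommGroup E] [NormedSpace ℂ E]
    {A : E → Matrix ι ι ℂ} {x : E} (hA : ∀ i j, AnalyticAt ℂ (fun y => A y i j) x) :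
    AnalyticAt ℂ (fun y => (A y).det) x := by
  simp only [Matrix.det_apply']
  exact Finset.analyticAt_fun_sum _ fun σ _ =>
    analyticAt_const.mul (Finset.analyticAt_fun_prod _ fun i _ => hA _ _)

lemma AnalyticAt.jacobian_apply {g : (ι → ℂ) → (ι → ℂ)} {x : ι → ℂ} (hg : AnalyticAt ℂ g x)
    (k i : ι) : AnalyticAt ℂ (fun y => jacobian g y k i) x :=
  hg.fderiv_apply_apply _ _

lemma AnalyticAt.jacobian_det {g : (ι → ℂ) → (ι → ℂ)} {x : ι → ℂ} (hg : AnalyticAt ℂ g x) :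
    AnalyticAt ℂ (fun y => (jacobian g y).det) x :=
  AnalyticAt.matrix_det hg.jacobian_apply

lemma Equiv.Perm.sum_sign_mul_eq_zero {j l : ι} (hjl : j ≠ l) (F : Equiv.Perm ι → ℂ)
    (hF : ∀ σ, F (σ * Equiv.swap j l) = F σ) :
    ∑ σ : Equiv.Perm ι, ((Equiv.Perm.sign σ : ℤ) : ℂ) * F σ = 0 := by
  have h := Equiv.sum_comp (Equiv.mulRight (Equiv.swap j l))
    (fun σ : Equiv.Perm ι => ((Equiv.Perm.sign σ : ℤ) : ℂ) * F σ)
  simp only [Equiv.coe_mulRight, hF, Equiv.Perm.sign_mul, Equiv.Perm.sign_swap hjl] at h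
  simp only [mul_neg, mul_one, Units.val_neg, Int.cast_neg, neg_mul, Finset.sum_neg_distrib] at h
  exact self_eq_neg.mp h.symm

/-- The rows of the cofactor matrix of a holomorphic map are divergence free (Piola identity). -/
lemma sum_sign_mul_fderiv_prod_eq_zero {g : (ι → ℂ) → (ι → ℂ)} {x : ι → ℂ}
    (hg : AnalyticAt ℂ g x) (j : ι) :
    ∑ σ : Equiv.Perm ι, ((Equiv.Perm.sign σ : ℤ) : ℂ) *
      fderiv ℂ (fun y => ∏ i ∈ Finset.univ.erase j, jacobian g y (σ i) i) x
        (Pi.single (σ j) 1) = 0 := by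
  have hd : ∀ (σ : Equiv.Perm ι), fderiv ℂ
      (fun y => ∏ i ∈ Finset.univ.erase j, jacobian g y (σ i) i) x (Pi.single (σ j) 1)
      = ∑ l ∈ Finset.univ.erase j,
        (∏ i ∈ (Finset.univ.erase j).erase l, jacobian g x (σ i) i) *
          fderiv ℂ (fun y => jacobian g y (σ l) l) x (Pi.single (σ j) 1) := by
    intro σ
    rw [fderiv_finsetProd fun i _ => (hg.jacobian_apply _ _).differentiableAt]
    simp
  have hsymm : ∀ a b l, fderiv ℂ (fun y => jacobian g y a l) x (Pi.single b 1)
      = fderiv ℂ (fun y => jacobian g y b l) x (Pi.single a 1) := by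
    have key : ∀ a b l, fderiv ℂ (fun y => jacobian g y a l) x (Pi.single b 1)
      = fderiv ℂ (fderiv ℂ g) x (Pi.single b 1) (Pi.single a 1) l := by
      intro a b l
      have h1 := hg.fderiv.differentiableAt.hasFDerivAt
      have h2 := ((ContinuousLinearMap.proj (R := ℂ) (φ := fun _ : ι => ℂ) l).comp
        (ContinuousLinearMap.apply ℂ (ι → ℂ) (Pi.single a 1))).hasFDerivAt.comp x h1
      have h3 : HasFDerivAt (fun y => jacobian g y a l) _ x := h2
      rw [h3.fderiv]
      rfl
    intro a b l
    have hs : IsSymmSndFDerivAt ℂ g x := hg.contDiffAt.isSymmSndFDerivAt_of_omega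
    rw [key, key, hs.eq]
  simp only [hd, Finset.mul_sum]
  rw [Finset.sum_comm]
  refine Finset.sum_eq_zero fun l hl => ?_
  have hlj : j ≠ l := (Finset.ne_of_mem_erase hl).symm
  refine Equiv.Perm.sum_sign_mul_eq_zero hlj (fun σ =>
    (∏ i ∈ (Finset.univ.erase j).erase l, jacobian g x (σ i) i) *
      fderiv ℂ (fun y => jacobian g y (σ l) l) x (Pi.single (σ j) 1)) fun σ => ?_
  congr 1
  · refine Finset.prod_congr rfl fun i hi => ?_
    have h1 := Finset.ne_of_mem_erase hi
    have h2 := Finset.ne_of_mem_erase (Finset.mem_of_mem_erase hi)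
    simp [Equiv.swap_apply_of_ne_of_ne h2 h1]
  · simp [hsymm (σ l) (σ j)]

end Jacobian

section Dbar

/-- The antiholomorphic part `∂F(w) + i ∂F(iw)` of the real derivative (twice `∂̄`). -/
def dbar {E : Type*} [NormedAddCommGroup E] [NormedSpace ℂ E] (F : E → ℂ) (x w : E) : ℂ :=
  fderiv ℝ F x w + Complex.I * fderiv ℝ F x (Complex.I • w)

variable {E : Type*} [NormedAddCommGroup E] [NormedSpace ℂ E]

lemma dbar_mul_mul_conj {u φ Q : E → ℂ} {x : E} (hu : DifferentiableAt ℝ u x)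
    (hφ : DifferentiableAt ℂ φ x) (hQ : DifferentiableAt ℂ Q x) (w : E) :
    dbar (fun y => u y * (φ y * conj (Q y))) x w =
      dbar u x w * (φ x * conj (Q x)) + u x * (φ x * (2 * conj (fderiv ℂ Q x w))) := by
  have h1 := hφ.hasFDerivAt.restrictScalars ℝ
  have h2 := Complex.conjCLE.toContinuousLinearMap.hasFDerivAt.comp x
    (hQ.hasFDerivAt.restrictScalars ℝ)
  have h3 := (hu.hasFDerivAt.mul (h1.mul h2))
  have h4 : HasFDerivAt (fun y => u y * (φ y * conj (Q y))) _ x := h3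
  simp only [dbar]
  rw [h4.fderiv]
  simp
  ring_nf
  simp
  ring

lemma dbar_conj_mul {Q : E → ℂ} {x : E} (hQ : DifferentiableAt ℂ Q x) (w : E) :
    dbar (fun y => Q y * conj (Q y)) x w = 2 * (Q x * conj (fderiv ℂ Q x w)) := by
  have h := dbar_mul_mul_conj (u := fun _ => (1 : ℂ)) (differentiableAt_const _) hQ hQ w
  simp only [one_mul] at h
  rw [h]
  simp [dbar]
  ring

end Dbar

section IBP

variable {E : Type*} [NormedAddCommGroup E] [NormedSpace ℝ E] [FiniteDimensional ℝ E]
  [MeasureSpace E] [BorelSpace E] [(volume : Measure E).IsAddHaarMeasure]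

lemma integral_fderiv_eq_zero_of_hasCompactSupport {F : E → ℂ} (hF : ContDiff ℝ 1 F)
    (hc : HasCompactSupport F) (w : E) : 
    Integrable (fun x => fderiv ℝ F x w) ∧ ∫ x, fderiv ℝ F x w = 0 := by
  have hcont : Continuous fun x => fderiv ℝ F x w :=
    (hF.continuous_fderiv one_ne_zero).clm_apply continuous_const
  have hi : Integrable (fun x => fderiv ℝ F x w) :=
    hcont.integrable_of_hasCompactSupport (hc.fderiv_apply ℝ w)
  have h := integral_mul_fderiv_eq_neg_fderiv_mul_of_integrable (μ := volume)
    (f := fun _ : E => (1 : ℂ)) (g := F) (v := w) (by simp) (by simpa using hi)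
    (by simpa using hF.continuous.integrable_of_hasCompactSupport hc)
    (fun x _ => differentiableAt_const _)
    (fun x _ => (hF.differentiable one_ne_zero) x)
  exact ⟨hi, by simpa using h⟩

end IBP

section Cutoff

/-- The truncated power `(a - s)₊ ^ k`. -/
def cutoff (a : ℝ) (k : ℕ) (s : ℝ) : ℝ := max (a - s) 0 ^ k

lemma cutoff_nonneg (a : ℝ) (k : ℕ) (s : ℝ) : 0 ≤ cutoff a k s :=
  pow_nonneg (le_max_right _ _) _

lemma cutoff_pos {a s : ℝ} (k : ℕ) (h : s < a) : 0 < cutoff a k s :=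
  pow_pos (lt_max_of_lt_left (sub_pos.mpr h)) _

lemma cutoff_eq_zero {a s : ℝ} {k : ℕ} (hk : k ≠ 0) (h : a ≤ s) : cutoff a k s = 0 := by
  simp [cutoff, max_eq_right (sub_nonpos.mpr h), hk]

lemma continuous_cutoff (a : ℝ) (k : ℕ) : Continuous (cutoff a k) := by
  unfold cutoff; fun_prop

lemma hasDerivAt_cutoff (a : ℝ) {k : ℕ} (hk : k ≠ 0) (s : ℝ) :
    HasDerivAt (cutoff a (k + 1)) (-((k + 1) * cutoff a k s)) s := by
  have hpoly : HasDerivAt (fun t : ℝ => (a - t) ^ (k + 1)) (-((k + 1) * (a - s) ^ k)) s := by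
    have h := ((hasDerivAt_id s).const_sub a).fun_pow (k + 1)
    exact h.congr_deriv (by simp)
  rcases lt_trichotomy s a with h | h | h
  · have hv : cutoff a k s = (a - s) ^ k := by
      simp [cutoff, max_eq_left (sub_nonneg.mpr h.le)]
    rw [hv]
    refine hpoly.congr_of_eventuallyEq ?_
    filter_upwards [gt_mem_nhds h] with t ht
    simp [cutoff, max_eq_left (sub_nonneg.mpr (le_of_lt ht))]
  · subst h
    have hl : HasDerivWithinAt (cutoff s (k + 1)) 0 (Iic s) s := by
      have h0 : HasDerivWithinAt (fun t : ℝ => (s - t) ^ (k + 1)) 0 (Iic s) s := by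
        simpa [hk] using hpoly.hasDerivWithinAt (s := Iic s)
      refine h0.congr (fun t ht => ?_) (by simp [cutoff])
      simp [cutoff, max_eq_left (sub_nonneg.mpr (mem_Iic.mp ht))]
    have hr : HasDerivWithinAt (cutoff s (k + 1)) 0 (Ici s) s := by
      refine (hasDerivWithinAt_const s (Ici s) (0 : ℝ)).congr (fun t ht => ?_) (by simp [cutoff])
      exact cutoff_eq_zero k.succ_ne_zero ht
    have := hl.union hr
    rw [Iic_union_Ici, hasDerivWithinAt_univ] at this
    simpa [cutoff, hk] using this
  · rw [cutoff_eq_zero hk h.le]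
    refine ((hasDerivAt_const s (0 : ℝ)).congr_of_eventuallyEq ?_).congr_deriv (by simp)
    filter_upwards [lt_mem_nhds h] with t ht
    exact cutoff_eq_zero k.succ_ne_zero (le_of_lt ht)

lemma contDiff_cutoff (a : ℝ) {k : ℕ} (hk : k ≠ 0) : ContDiff ℝ 1 (cutoff a (k + 1)) := by
  refine contDiff_one_iff_deriv.mpr ⟨fun s => (hasDerivAt_cutoff a hk s).differentiableAt, ?_⟩
  rw [show deriv (cutoff a (k + 1)) = fun s => -((k + 1) * cutoff a k s) from
    funext fun s => (hasDerivAt_cutoff a hk s).deriv]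
  have := continuous_cutoff a k
  fun_prop

end Cutoff

section IBP

variable {ι : Type*} [Fintype ι]

/-- The squared Hermitian norm on `ι → ℂ`. -/
def normSqSum (z : ι → ℂ) : ℝ := ∑ i, ‖z i‖ ^ 2

lemma contDiff_normSqSum : ContDiff ℝ 1 (normSqSum : (ι → ℂ) → ℝ) := by
  unfold normSqSum
  exact ContDiff.sum fun i _ => (contDiff_apply ℝ ℂ i).norm_sq ℝ

lemma continuous_normSqSum : Continuous (normSqSum : (ι → ℂ) → ℝ) :=
  contDiff_normSqSum.continuous

lemma normSqSum_nonneg (z : ι → ℂ) : 0 ≤ normSqSum z :=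
  Finset.sum_nonneg fun _ _ => by positivity

lemma normSqSum_eq_zero {z : ι → ℂ} : normSqSum z = 0 ↔ z = 0 := by
  rw [normSqSum, Finset.sum_eq_zero_iff_of_nonneg fun _ _ => by positivity]
  simp [funext_iff]

lemma ofReal_normSqSum (z : ι → ℂ) : (normSqSum z : ℂ) = ∑ i, z i * conj (z i) := by
  simp [normSqSum, Complex.mul_conj']

variable {E : Type*} [NormedAddCommGroup E] [NormedSpace ℂ E]

lemma dbar_normSqSum {g : E → (ι → ℂ)} {x : E} (hg : DifferentiableAt ℂ g x) (w : E) :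
    dbar (fun y => (normSqSum (g y) : ℂ)) x w =
      2 * ∑ i, g x i * conj (fderiv ℂ g x w i) := by
  have hgi : ∀ i, HasFDerivAt (fun y => g y i)
      ((ContinuousLinearMap.proj i).comp (fderiv ℂ g x)) x :=
    hasFDerivAt_pi'.mp hg.hasFDerivAt
  have hd : ∀ i, DifferentiableAt ℝ (fun y => g y i * conj (g y i)) x := fun i =>
    ((hgi i).differentiableAt.restrictScalars ℝ).mul
      (Complex.conjCLE.differentiableAt.comp x ((hgi i).differentiableAt.restrictScalars ℝ))
  have h : ∀ i, dbar (fun y => g y i * conj (g y i)) x w = 2 * (g x i * conj (fderiv ℂ g x w i)) :=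
    fun i => by rw [dbar_conj_mul (hgi i).differentiableAt, (hgi i).fderiv]; rfl
  simp only [ofReal_normSqSum, Finset.mul_sum, ← h]
  simp only [dbar]
  rw [fderiv_fun_sum fun i _ => hd i]
  simp [Finset.sum_add_distrib, Finset.mul_sum]

lemma dbar_cutoff_normSqSum {g : E → (ι → ℂ)} {x : E} (hg : DifferentiableAt ℂ g x) (a : ℝ)
    {k : ℕ} (hk : k ≠ 0) (w : E) :
    dbar (fun y => (cutoff a (k + 1) (normSqSum (g y)) : ℂ)) x w =
      -(2 * (k + 1) * cutoff a k (normSqSum (g x))) * ∑ i, g x i * conj (fderiv ℂ g x w i) := by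
  have hN : DifferentiableAt ℝ (fun y => normSqSum (g y)) x :=
    ((contDiff_normSqSum.differentiable one_ne_zero) (g x)).comp x (hg.restrictScalars ℝ)
  have h1 : HasFDerivAt (fun y => (normSqSum (g y) : ℂ)) _ x :=
    Complex.ofRealCLM.hasFDerivAt.comp x hN.hasFDerivAt
  have h2 : HasFDerivAt (fun y => (cutoff a (k + 1) (normSqSum (g y)) : ℂ)) _ x :=
    Complex.ofRealCLM.hasFDerivAt.comp x
      ((hasDerivAt_cutoff a hk _).comp_hasFDerivAt x hN.hasFDerivAt)
  have h3 := dbar_normSqSum hg w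
  simp only [dbar] at h3 ⊢
  rw [h1.fderiv] at h3
  rw [h2.fderiv]
  simp at h3 ⊢
  linear_combination (-((k + 1) * cutoff a k (normSqSum (g x)) : ℂ)) * h3

end IBP

section Residue

variable {ι : Type*} [Fintype ι] [DecidableEq ι]

lemma integral_sum_dbar_mul_eq_zero {g : (ι → ℂ) → (ι → ℂ)} {φ u : (ι → ℂ) → ℂ}
    {K Ω : Set (ι → ℂ)} (hK : IsCompact K) (hKΩ : K ⊆ Ω)
    (hg : AnalyticOnNhd ℂ g Ω) (hφ : AnalyticOnNhd ℂ φ Ω) (hu : ContDiff ℝ 1 u)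
    (huK : ∀ x ∉ K, u x = 0) (j : ι) :
    ∫ x in K, ∑ σ : Equiv.Perm ι, ((Equiv.Perm.sign σ : ℤ) : ℂ) *
      (dbar u x (Pi.single (σ j) 1) *
        (φ x * conj (∏ i ∈ Finset.univ.erase j, jacobian g x (σ i) i))) = 0 := by
  set Q : Equiv.Perm ι → (ι → ℂ) → ℂ := fun σ x =>
    ∏ i ∈ Finset.univ.erase j, jacobian g x (σ i) i
  have hQ : ∀ σ, ∀ x ∈ Ω, AnalyticAt ℂ (Q σ) x := fun σ x hx =>
    Finset.analyticAt_fun_prod _ fun i _ => (hg x hx).jacobian_apply _ _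
  set F : Equiv.Perm ι → (ι → ℂ) → ℂ := fun σ x => u x * (φ x * conj (Q σ x))
  have hF0 : ∀ σ, ∀ x ∉ K, F σ x = 0 := fun σ x hx => by simp [F, huK x hx]
  have hF : ∀ σ, ContDiff ℝ 1 (F σ) := by
    intro σ
    refine contDiff_iff_contDiffAt.mpr fun x => ?_
    by_cases hx : x ∈ K
    · refine hu.contDiffAt.mul (((hφ x (hKΩ hx)).contDiffAt.restrict_scalars ℝ).mul ?_)
      exact Complex.conjCLE.contDiff.contDiffAt.comp x
        ((hQ σ x (hKΩ hx)).contDiffAt.restrict_scalars ℝ)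
    · refine (contDiffAt_const (c := (0 : ℂ))).congr_of_eventuallyEq ?_
      filter_upwards [hK.isClosed.isOpen_compl.mem_nhds hx] with y hy using hF0 σ y hy
  have hFc : ∀ σ, HasCompactSupport (F σ) := fun σ => HasCompactSupport.intro hK (hF0 σ)
  have hsum : ∫ x, ∑ σ : Equiv.Perm ι, ((Equiv.Perm.sign σ : ℤ) : ℂ) *
      dbar (F σ) x (Pi.single (σ j) 1) = 0 := by
    have h1 := fun σ => integral_fderiv_eq_zero_of_hasCompactSupport (hF σ) (hFc σ)
    rw [integral_finsetSum]
    · refine Finset.sum_eq_zero fun σ _ => ?_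
      rw [integral_const_mul]
      simp only [dbar]
      rw [integral_add (h1 σ _).1 ((h1 σ _).1.const_mul _), integral_const_mul,
        (h1 σ _).2, (h1 σ _).2]
      simp
    · exact fun σ _ => ((h1 σ _).1.add ((h1 σ _).1.const_mul _)).const_mul _
  have hset : ∫ x in K, ∑ σ : Equiv.Perm ι, ((Equiv.Perm.sign σ : ℤ) : ℂ) *
      dbar (F σ) x (Pi.single (σ j) 1) = ∫ x, ∑ σ : Equiv.Perm ι,
      ((Equiv.Perm.sign σ : ℤ) : ℂ) * dbar (F σ) x (Pi.single (σ j) 1) := by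
    refine setIntegral_eq_integral_of_forall_compl_eq_zero fun x hx => ?_
    refine Finset.sum_eq_zero fun σ _ => ?_
    have : F σ =ᶠ[𝓝 x] fun _ => 0 := by
      filter_upwards [hK.isClosed.isOpen_compl.mem_nhds hx] with y hy using hF0 σ y hy
    simp [dbar, this.fderiv_eq]
  rw [← hsum, ← hset]
  refine setIntegral_congr_fun hK.measurableSet fun x hx => ?_
  have hxΩ := hKΩ hx
  simp only [F]
  have e : ∀ σ, dbar (fun x => u x * (φ x * conj (Q σ x))) x (Pi.single (σ j) 1) = _ :=
    fun σ => dbar_mul_mul_conj (hu.differentiable one_ne_zero x)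
      (hφ x hxΩ).differentiableAt (hQ σ x hxΩ).differentiableAt (Pi.single (σ j) 1)
  simp only [e, mul_add, Finset.sum_add_distrib]
  have hp := congrArg conj (sum_sign_mul_fderiv_prod_eq_zero (hg x hxΩ) j)
  rw [left_eq_add]
  simp only [map_sum, map_mul, map_intCast, map_zero] at hp
  calc _ = u x * φ x * 2 * ∑ σ : Equiv.Perm ι, ((Equiv.Perm.sign σ : ℤ) : ℂ) *
        conj (fderiv ℂ (Q σ) x (Pi.single (σ j) 1)) := by
          rw [Finset.mul_sum]
          exact Finset.sum_congr rfl fun σ _ => by ring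
    _ = 0 := by rw [hp, mul_zero]

lemma sum_sign_mul_cofactor (A : Matrix ι ι ℂ) (j l : ι) :
    ∑ σ : Equiv.Perm ι, ((Equiv.Perm.sign σ : ℤ) : ℂ) *
      (A (σ j) l * ∏ i ∈ Finset.univ.erase j, A (σ i) i) = if l = j then A.det else 0 := by
  have h : (A.updateCol j fun k => A k l).det = if l = j then A.det else 0 := by
    split_ifs with hl
    · subst hl
      congr 1
      exact Matrix.updateCol_eq_self A l
    · refine Matrix.det_zero_of_column_eq hl fun k => ?_
      simp [hl]
  rw [← h, Matrix.det_apply']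
  refine Finset.sum_congr rfl fun σ _ => ?_
  rw [← Finset.mul_prod_erase _ _ (Finset.mem_univ j)]
  congr 2
  · simp
  · refine Finset.prod_congr rfl fun i hi => ?_
    simp [Finset.ne_of_mem_erase hi]

/-- The functional `φ ↦ ∫ χ(|g|²) φ conj(det Dg)` annihilates the ideal generated by the
components of `g`. -/
theorem integral_cutoff_mul_component_eq_zero {g : (ι → ℂ) → (ι → ℂ)} {φ : (ι → ℂ) → ℂ}
    {K Ω : Set (ι → ℂ)} (hK : IsCompact K) (hKΩ : K ⊆ Ω)
    (hg : AnalyticOnNhd ℂ g Ω) (hφ : AnalyticOnNhd ℂ φ Ω) {a : ℝ}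
    (ha : ∀ x ∈ frontier K, a < normSqSum (g x)) {k : ℕ} (hk : k ≠ 0) (j : ι) :
    ∫ x in K, (cutoff a k (normSqSum (g x)) : ℂ) *
      (g x j * φ x * conj (jacobian g x).det) = 0 := by
  set v : (ι → ℂ) → ℂ := fun x => (cutoff a (k + 1) (normSqSum (g x)) : ℂ) with hv
  set u : (ι → ℂ) → ℂ := K.indicator v
  have hNc : ∀ x ∈ K, ContinuousAt (fun y => normSqSum (g y)) x := fun x hx =>
    continuous_normSqSum.continuousAt.comp (hg x (hKΩ hx)).continuousAt
  have huv : ∀ x ∈ K, u =ᶠ[𝓝 x] v := by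
    intro x hx
    by_cases hi : x ∈ interior K
    · filter_upwards [mem_interior_iff_mem_nhds.mp hi] with y hy using indicator_of_mem hy v
    · have hf : x ∈ frontier K := ⟨subset_closure hx, hi⟩
      filter_upwards [(hNc x hx).eventually (lt_mem_nhds (ha x hf))] with y hy
      have h0 : v y = 0 := by
        simp only [hv, cutoff_eq_zero k.succ_ne_zero (le_of_lt hy), Complex.ofReal_zero]
      by_cases hyK : y ∈ K
      · exact indicator_of_mem hyK v
      · rw [h0]; exact indicator_of_notMem hyK v
  have hu : ContDiff ℝ 1 u := by
    refine contDiff_iff_contDiffAt.mpr fun x => ?_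
    by_cases hx : x ∈ K
    · refine ContDiffAt.congr_of_eventuallyEq ?_ (huv x hx)
      refine Complex.ofRealCLM.contDiff.contDiffAt.comp x
        ((contDiff_cutoff a hk).contDiffAt.comp x ?_)
      exact contDiff_normSqSum.contDiffAt.comp x
        ((hg x (hKΩ hx)).contDiffAt.restrict_scalars ℝ)
    · refine (contDiffAt_const (c := (0 : ℂ))).congr_of_eventuallyEq ?_
      filter_upwards [hK.isClosed.isOpen_compl.mem_nhds hx] with y hy
        using indicator_of_notMem hy v
  have key := integral_sum_dbar_mul_eq_zero hK hKΩ hg hφ hu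
    (fun x hx => indicator_of_notMem hx v) j
  have hc : (-(2 * (k + 1)) : ℂ) ≠ 0 := by
    have : ((k : ℂ) + 1) ≠ 0 := by exact_mod_cast k.succ_ne_zero
    simpa using this
  refine (mul_eq_zero.mp (?_ : (-(2 * (k + 1)) : ℂ) * _ = 0)).resolve_left hc
  rw [← integral_const_mul, ← key]
  refine setIntegral_congr_fun hK.measurableSet fun x hx => ?_
  have hd : ∀ w, dbar u x w = _ := fun w =>
    (show dbar u x w = dbar v x w by simp only [dbar, (huv x hx).fderiv_eq]).trans
      (dbar_cutoff_normSqSum (hg x (hKΩ hx)).differentiableAt a hk w)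
  simp only [hd]
  have hJ : ∀ l, ∑ σ : Equiv.Perm ι, ((Equiv.Perm.sign σ : ℤ) : ℂ) *
      (conj (jacobian g x (σ j) l) * conj (∏ i ∈ Finset.univ.erase j, jacobian g x (σ i) i))
      = if l = j then conj (jacobian g x).det else 0 := by
    intro l
    have := congrArg conj (sum_sign_mul_cofactor (jacobian g x) j l)
    simp only [map_sum, map_mul, map_intCast, apply_ite conj, map_zero] at this ⊢
    exact this
  have hsum : ∑ l, g x l * (if l = j then conj (jacobian g x).det else 0) =
      g x j * conj (jacobian g x).det := by simp
  calc _ = -(2 * (k + 1) * cutoff a k (normSqSum (g x))) * φ x *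
        ∑ l, g x l * (if l = j then conj (jacobian g x).det else 0) := by rw [hsum]; ring
    _ = _ := by
      simp only [← hJ, Finset.mul_sum, Finset.sum_mul]
      rw [Finset.sum_comm]
      refine Finset.sum_congr rfl fun σ _ => Finset.sum_congr rfl fun l _ => ?_
      simp only [jacobian, Matrix.of_apply]
      ring

end Residue

section Parametric

variable {H X : Type*} [NormedAddCommGroup H] [NormedSpace ℝ H] [ProperSpace H]
  [TopologicalSpace X] [T2Space X] [MeasurableSpace X] [OpensMeasurableSpace X] {μ : Measure X}
  [IsFiniteMeasureOnCompacts μ]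

lemma hasFDerivAt_integral_of_continuousOn {F : H → X → ℂ} {F' : H → X → H →L[ℝ] ℂ}
    {K : Set X} {U : Set H} {y₀ : H} (hK : IsCompact K) (hU : U ∈ 𝓝 y₀)
    (hF : ∀ y ∈ U, ContinuousOn (F y) K)
    (hF' : ContinuousOn (fun p : H × X => F' p.1 p.2) (U ×ˢ K))
    (hd : ∀ y ∈ U, ∀ x ∈ K, HasFDerivAt (fun y => F y x) (F' y x) y) :
    IntegrableOn (F' y₀) K μ ∧
    HasFDerivAt (fun y => ∫ x in K, F y x ∂μ) (∫ x in K, F' y₀ x ∂μ) y₀ := by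
  obtain ⟨r, hr, hrU⟩ := Metric.nhds_basis_closedBall.mem_iff.mp hU
  have hc : IsCompact (Metric.closedBall y₀ r ×ˢ K) := (isCompact_closedBall _ _).prod hK
  have hcont := hF'.mono (prod_mono_left (t := K) hrU)
  obtain ⟨C, hC⟩ := hc.exists_bound_of_continuousOn hcont
  have h0 : ContinuousOn (F' y₀) K :=
    hF'.comp (by fun_prop : ContinuousOn (fun x : X => (y₀, x)) K)
      fun x hx => ⟨mem_of_mem_nhds hU, hx⟩
  refine ⟨h0.integrableOn_compact hK, ?_⟩
  have hm := hK.measurableSet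
  refine hasFDerivAt_integral_of_dominated_of_fderiv_le (bound := fun _ => C)
    (Metric.closedBall_mem_nhds y₀ hr) ?_ ?_ ?_ ?_ ?_ ?_
  · filter_upwards [hU] with y hy
    exact ((hF y hy).integrableOn_compact hK).aestronglyMeasurable
  · exact (hF y₀ (mem_of_mem_nhds hU)).integrableOn_compact hK
  · exact (h0.integrableOn_compact hK).aestronglyMeasurable
  · exact (ae_restrict_iff' hm).mpr (ae_of_all _ fun x hx y hy => hC (y, x) ⟨hy, hx⟩)
  · exact continuousOn_const.integrableOn_compact hK
  · exact (ae_restrict_iff' hm).mpr (ae_of_all _ fun x hx y hy => hd y (hrU hy) x hx)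

end Parametric

section Dbar

variable {E : Type*} [NormedAddCommGroup E] [NormedSpace ℂ E]

lemma HasFDerivAt.differentiableAt_of_dbar {f : E → ℂ} {L : E →L[ℝ] ℂ} {x : E}
    (h : HasFDerivAt f L x) (hL : ∀ w, L w + Complex.I * L (Complex.I • w) = 0) :
    DifferentiableAt ℂ f x := by
  have hI : ∀ w, L (Complex.I • w) = Complex.I * L w := fun w => by
    linear_combination (-Complex.I) * hL w + L (Complex.I • w) * Complex.I_sq
  let L' : E →L[ℂ] ℂ :=
    { toFun := L
      map_add' := L.map_add
      map_smul' := fun c w => by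
        have hc : c • w = c.re • w + c.im • (Complex.I • w) := by
          nth_rw 1 [← Complex.re_add_im c]
          rw [add_smul, mul_smul, Complex.coe_smul, Complex.coe_smul]
        rw [hc, map_add, map_smul, map_smul, hI, RingHom.id_apply, smul_eq_mul]
        simp only [Complex.real_smul]
        linear_combination L w * Complex.re_add_im c
      cont := L.cont }
  exact (hasFDerivAt_of_restrictScalars (f' := L') ℝ h (by ext; rfl)).differentiableAt

end Dbar

section Residue

variable {ι : Type*} [Fintype ι] [DecidableEq ι]

lemma jacobian_sub_const (g : (ι → ℂ) → (ι → ℂ)) (y x : ι → ℂ) :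
    jacobian (fun x => g x - y) x = jacobian g x := by
  simp [jacobian, fderiv_sub_const]

/-- A smoothed trace of `φ · Dg` along the fibres of the map `g`. -/
def fiberTrace (g : (ι → ℂ) → (ι → ℂ)) (K : Set (ι → ℂ)) (a : ℝ) (φ : (ι → ℂ) → ℂ)
    (y : ι → ℂ) : ℂ :=
  ∫ x in K, (cutoff a 2 (normSqSum (g x - y)) : ℂ) * (φ x * conj (jacobian g x).det)

variable {g : (ι → ℂ) → (ι → ℂ)} {φ : (ι → ℂ) → ℂ} {K Ω : Set (ι → ℂ)} {a : ℝ} {y : ι → ℂ}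

lemma continuousOn_mul_conj_jacobian (hKΩ : K ⊆ Ω) (hg : AnalyticOnNhd ℂ g Ω)
    (hφ : ContinuousOn φ K) : ContinuousOn (fun x => φ x * conj (jacobian g x).det) K := by
  have hJ : ContinuousOn (fun x => (jacobian g x).det) K := fun x hx =>
    (hg x (hKΩ hx)).jacobian_det.continuousAt.continuousWithinAt
  exact hφ.mul (Complex.continuous_conj.comp_continuousOn hJ)

lemma integral_cutoff_mul_component_sub_eq_zero (hK : IsCompact K) (hKΩ : K ⊆ Ω)
    (hg : AnalyticOnNhd ℂ g Ω) (hφ : AnalyticOnNhd ℂ φ Ω)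
    (ha : ∀ x ∈ frontier K, a < normSqSum (g x - y)) {k : ℕ} (hk : k ≠ 0) (j : ι) :
    ∫ x in K, (cutoff a k (normSqSum (g x - y)) : ℂ) *
      ((g x j - y j) * φ x * conj (jacobian g x).det) = 0 := by
  have := integral_cutoff_mul_component_eq_zero (g := fun x => g x - y) hK hKΩ
    (fun x hx => (hg x hx).sub analyticAt_const) hφ ha hk j
  simpa only [jacobian_sub_const, Pi.sub_apply] using this

lemma differentiableAt_fiberTrace (hK : IsCompact K) (hKΩ : K ⊆ Ω)
    (hg : AnalyticOnNhd ℂ g Ω) (hφ : AnalyticOnNhd ℂ φ Ω)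
    (ha : ∀ x ∈ frontier K, a < normSqSum (g x - y)) :
    DifferentiableAt ℂ (fiberTrace g K a φ) y := by
  set ψ : (ι → ℂ) → ℂ := fun x => φ x * conj (jacobian g x).det
  have hψ : ContinuousOn ψ K := continuousOn_mul_conj_jacobian hKΩ hg
    (hφ.continuousOn.mono hKΩ)
  have hgc : ContinuousOn g K := hg.continuousOn.mono hKΩ
  set M : (ι → ℂ) → ℂ := fun z => (cutoff a 2 (normSqSum z) : ℂ)
  have hM : ContDiff ℝ 1 M :=
    Complex.ofRealCLM.contDiff.comp ((contDiff_cutoff a one_ne_zero).comp contDiff_normSqSum)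
  set DM : (ι → ℂ) → (ι → ℂ) → (ι → ℂ) →L[ℝ] ℂ := fun y x => -(ψ x • fderiv ℝ M (g x - y))
  have hmain := hasFDerivAt_integral_of_continuousOn (μ := volume) (y₀ := y) (U := univ)
    (F := fun y x => M (g x - y) * ψ x) (F' := DM) hK univ_mem ?_ ?_ ?_
  · refine hmain.2.differentiableAt_of_dbar fun w => ?_
    rw [ContinuousLinearMap.integral_apply hmain.1, ContinuousLinearMap.integral_apply hmain.1,
      ← integral_const_mul, ← integral_add (hmain.1.apply_continuousLinearMap _)
        ((hmain.1.apply_continuousLinearMap _).const_mul _)]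
    have hz : ∀ i, IntegrableOn (fun x => (cutoff a 1 (normSqSum (g x - y)) : ℂ) *
        ((g x i - y i) * φ x * conj (jacobian g x).det)) K := by
      intro i
      refine ContinuousOn.integrableOn_compact hK ?_
      have h1 : ContinuousOn (fun x => (cutoff a 1 (normSqSum (g x - y)) : ℂ)) K :=
        (Complex.continuous_ofReal.comp ((continuous_cutoff a 1).comp
          continuous_normSqSum)).comp_continuousOn (hgc.sub continuousOn_const)
      have h2 : ContinuousOn (fun x => (g x i - y i)) K :=
        ((continuous_apply i).comp_continuousOn hgc).sub continuousOn_const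
      exact (h1.mul (h2.mul hψ)).congr fun x _ => by simp [ψ, mul_assoc]
    calc _ = ∫ x in K, ∑ i, (4 * conj (w i)) * ((cutoff a 1 (normSqSum (g x - y)) : ℂ) *
        ((g x i - y i) * φ x * conj (jacobian g x).det)) := by
          refine setIntegral_congr_fun hK.measurableSet fun x hx => ?_
          have hd := dbar_cutoff_normSqSum (g := fun z : ι → ℂ => z) (x := g x - y)
            differentiableAt_fun_id a one_ne_zero w
          simp only [dbar, fderiv_fun_id] at hd
          simp only [DM, neg_apply, smul_apply, smul_eq_mul]
          calc _ = -ψ x * (fderiv ℝ M (g x - y) w +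
              Complex.I * fderiv ℝ M (g x - y) (Complex.I • w)) := by ring
            _ = _ := by
              rw [hd]
              simp only [Finset.mul_sum, ψ]
              refine Finset.sum_congr rfl fun i _ => ?_
              simp
              ring
      _ = 0 := by
        rw [integral_finsetSum _ fun i _ => (hz i).const_mul _]
        refine Finset.sum_eq_zero fun i _ => ?_
        rw [integral_const_mul,
          integral_cutoff_mul_component_sub_eq_zero hK hKΩ hg hφ ha one_ne_zero, mul_zero]
  · exact fun y _ => (hM.continuous.comp_continuousOn (hgc.sub continuousOn_const)).mul hψ
  · have h1 : ContinuousOn (fun p : (ι → ℂ) × (ι → ℂ) => ψ p.2) (univ ×ˢ K) :=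
      hψ.comp continuousOn_snd fun p hp => hp.2
    have h2 : ContinuousOn (fun p : (ι → ℂ) × (ι → ℂ) => g p.2 - p.1) (univ ×ˢ K) :=
      (hgc.comp continuousOn_snd fun p hp => hp.2).sub continuousOn_fst
    exact (h1.smul ((hM.continuous_fderiv one_ne_zero).comp_continuousOn h2)).neg
  · intro y _ x hx
    have h1 : HasFDerivAt M (fderiv ℝ M (g x - y)) (g x - y) :=
      (hM.differentiable one_ne_zero _).hasFDerivAt
    have h2 := (h1.comp y ((hasFDerivAt_id y).const_sub (g x))).mul_const (ψ x)
    refine h2.congr_fderiv ?_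
    ext w
    simp [DM]

/-- `fiberTrace` is linear over functions on the target. -/
lemma fiberTrace_comp_mul {R : ℝ} {r : (ι → ℂ) → ℂ} (hK : IsCompact K) (hKΩ : K ⊆ Ω)
    (hg : AnalyticOnNhd ℂ g Ω) (hφ : AnalyticOnNhd ℂ φ Ω)
    (ha : ∀ x ∈ frontier K, a < normSqSum (g x - y))
    (hr : AnalyticOnNhd ℂ r (Metric.ball 0 (5 * R))) (hgR : MapsTo g Ω (Metric.ball 0 R))
    (hy : y ∈ Metric.ball 0 R) :
    fiberTrace g K a (fun x => r (g x) * φ x) y = r y * fiberTrace g K a φ y := by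
  set ψ : (ι → ℂ) → ℂ := fun x => φ x * conj (jacobian g x).det
  have hψ : ContinuousOn ψ K := continuousOn_mul_conj_jacobian hKΩ hg
    (hφ.continuousOn.mono hKΩ)
  have hgc : ContinuousOn g K := hg.continuousOn.mono hKΩ
  set χ : (ι → ℂ) → ℂ := fun x => (cutoff a 2 (normSqSum (g x - y)) : ℂ)
  have hχ : ContinuousOn χ K := (Complex.continuous_ofReal.comp ((continuous_cutoff a 2).comp
          continuous_normSqSum)).comp_continuousOn (hgc.sub continuousOn_const)
  set p : ℝ → (ι → ℂ) → (ι → ℂ) := fun t x => y + (t : ℂ) • (g x - y)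
  have hp : ∀ t ∈ Ioo (-1 : ℝ) 2, ∀ x ∈ Ω, p t x ∈ Metric.ball (0 : ι → ℂ) (5 * R) := by
    intro t ht x hx
    have h1 : ‖g x‖ < R := by simpa using hgR hx
    have h2 : ‖y‖ < R := by simpa using hy
    have h3 : |t| ≤ 2 := abs_le.mpr ⟨by linarith [ht.1], ht.2.le⟩
    rw [mem_ball_zero_iff]
    calc ‖p t x‖ ≤ ‖y‖ + |t| * ‖g x - y‖ := by
          refine (norm_add_le _ _).trans (le_of_eq ?_)
          rw [norm_smul, Complex.norm_real, Real.norm_eq_abs]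
      _ ≤ ‖y‖ + 2 * (‖g x‖ + ‖y‖) := by
          gcongr
          exact norm_sub_le _ _
      _ < 5 * R := by linarith
  have hpc : ContinuousOn (fun q : ℝ × (ι → ℂ) => p q.1 q.2) (Ioo (-1) 2 ×ˢ K) := by
    have h2 : ContinuousOn (fun q : ℝ × (ι → ℂ) => g q.2) (Ioo (-1) 2 ×ˢ K) :=
      hgc.comp continuousOn_snd fun p hp => hp.2
    fun_prop
  set D : ℝ → (ι → ℂ) → ℂ := fun t x => χ x * (fderiv ℂ r (p t x) (g x - y) * ψ x)
  have hDc : ContinuousOn (fun q : ℝ × (ι → ℂ) => D q.1 q.2) (Ioo (-1) 2 ×ˢ K) := by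
    have hs : ∀ {u : (ι → ℂ) → ℂ}, ContinuousOn u K →
        ContinuousOn (fun q : ℝ × (ι → ℂ) => u q.2) (Ioo (-1) 2 ×ˢ K) :=
      fun hu => hu.comp continuousOn_snd fun p hp => hp.2
    have h3 : ContinuousOn (fun q : ℝ × (ι → ℂ) => fderiv ℂ r (p q.1 q.2)) (Ioo (-1) 2 ×ˢ K) :=
      hr.fderiv.continuousOn.comp hpc fun q hq => hp q.1 hq.1 q.2 (hKΩ hq.2)
    have h4 : ContinuousOn (fun q : ℝ × (ι → ℂ) => g q.2 - y) (Ioo (-1) 2 ×ˢ K) :=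
      (hgc.comp continuousOn_snd fun p hp => hp.2).sub continuousOn_const
    exact (hs hχ).mul ((h3.clm_apply h4).mul (hs hψ))
  set Θ : ℝ → ℂ := fun t => ∫ x in K, χ x * (r (p t x) * ψ x)
  have hder : ∀ t ∈ Ioo (-1 : ℝ) 2, HasDerivAt Θ 0 t := by
    intro t ht
    have hmain := hasFDerivAt_integral_of_continuousOn (μ := volume) (y₀ := t)
      (U := Ioo (-1 : ℝ) 2) (F := fun t x => χ x * (r (p t x) * ψ x))
      (F' := fun t x => ContinuousLinearMap.toSpanSingleton ℝ (D t x)) hK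
      (isOpen_Ioo.mem_nhds ht) ?_ ?_ ?_
    · have h1 := hmain.2.hasDerivAt
      refine h1.congr_deriv ?_
      rw [ContinuousLinearMap.integral_apply hmain.1]
      simp only [ContinuousLinearMap.toSpanSingleton_apply, one_smul]
      have hsingle : ∀ i,
          AnalyticOnNhd ℂ (fun x => fderiv ℂ r (p t x) (Pi.single i 1) * φ x) Ω := by
        intro i x hx
        refine AnalyticAt.mul ?_ (hφ x hx)
        have h5 : AnalyticAt ℂ (p t) x :=
          analyticAt_const.fun_add (analyticAt_const.fun_smul ((hg x hx).fun_sub analyticAt_const))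
        exact (((ContinuousLinearMap.apply ℂ ℂ (Pi.single i (1 : ℂ))).analyticAt _).comp
          (hr _ (hp t ht x hx)).fderiv).comp h5
      have hz := fun i => integral_cutoff_mul_component_sub_eq_zero hK hKΩ hg (hsingle i) ha
        two_ne_zero i
      calc _ = ∫ x in K, ∑ i, χ x * ((g x i - y i) *
            (fderiv ℂ r (p t x) (Pi.single i 1) * φ x) * conj (jacobian g x).det) := by
            refine setIntegral_congr_fun hK.measurableSet fun x hx => ?_
            have h6 : fderiv ℂ r (p t x) (g x - y) =
                ∑ i, (g x i - y i) * fderiv ℂ r (p t x) (Pi.single i 1) := by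
              conv_lhs => rw [pi_eq_sum_univ' (g x - y)]
              simp
            simp only [D, h6, ψ, Finset.mul_sum, Finset.sum_mul]
            exact Finset.sum_congr rfl fun i _ => by ring
        _ = 0 := by
          rw [integral_finsetSum]
          · exact Finset.sum_eq_zero fun i _ => hz i
          · intro i _
            refine ContinuousOn.integrableOn_compact hK (hχ.mul ?_)
            exact ((((continuous_apply i).comp_continuousOn hgc).sub continuousOn_const).mul
              ((hsingle i).continuousOn.mono hKΩ)).mul
              (Complex.continuous_conj.comp_continuousOn fun x hx =>
                (hg x (hKΩ hx)).jacobian_det.continuousAt.continuousWithinAt)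
    · intro t ht
      refine hχ.mul (ContinuousOn.mul ?_ hψ)
      refine hr.continuousOn.comp ?_ fun x hx => hp t ht x (hKΩ hx)
      fun_prop
    · exact (ContinuousLinearMap.toSpanSingletonCLE (𝕜 := ℝ) (E := ℂ)).continuous.comp_continuousOn
        hDc
    · intro t ht x hx
      have h1 : HasDerivAt (fun t : ℝ => p t x) (g x - y) t := by
        have := (Complex.ofRealCLM.hasDerivAt (x := t)).smul_const (g x - y)
        simpa [p] using this.const_add y
      have h2 := ((hr _ (hp t ht x (hKΩ hx))).differentiableAt.hasFDerivAt.restrictScalars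
        ℝ).comp_hasDerivAt t h1
      exact ((h2.mul_const (ψ x)).const_mul (χ x)).hasFDerivAt
  have hΘ : Θ 1 = Θ 0 :=
    isOpen_Ioo.is_const_of_deriv_eq_zero isPreconnected_Ioo
      (fun t ht => (hder t ht).differentiableAt.differentiableWithinAt)
      (fun t ht => (hder t ht).deriv) (by norm_num) (by norm_num)
  have e1 : Θ 1 = fiberTrace g K a (fun x => r (g x) * φ x) y := by
    simp [Θ, p, fiberTrace, χ, ψ, mul_assoc]
  have e0 : Θ 0 = r y * fiberTrace g K a φ y := by
    simp only [Θ, p, fiberTrace, χ, ψ, ← integral_const_mul]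
    congr 1
    ext x
    simp
    ring
  rw [← e1, hΘ, e0]

end Residue

section Positivity

variable {ι : Type*} [Fintype ι]

lemma setIntegral_ofReal_ne_zero {X : Type*} [TopologicalSpace X] [T2Space X]
    [MeasurableSpace X] [OpensMeasurableSpace X] {μ : Measure X} [IsFiniteMeasureOnCompacts μ]
    [μ.IsOpenPosMeasure] {K : Set X} (hK : IsCompact K) {h : X → ℝ} (hc : ContinuousOn h K)
    (h0 : ∀ x ∈ K, 0 ≤ h x) (hpos : ∃ x ∈ interior K, 0 < h x) :
    ∫ x in K, (h x : ℂ) ∂μ ≠ 0 := by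
  obtain ⟨x, hxK, hx⟩ := hpos
  rw [integral_complex_ofReal, Complex.ofReal_ne_zero]
  refine ne_of_gt ((setIntegral_pos_iff_support_of_nonneg_ae
    ((ae_restrict_iff' hK.measurableSet).mpr (ae_of_all _ h0))
    (hc.integrableOn_compact hK)).mpr ?_)
  have hn : ∀ᶠ y in 𝓝 x, y ∈ Function.support h ∩ K := by
    have hKx := mem_interior_iff_mem_nhds.mp hxK
    filter_upwards [hKx, (hc.continuousAt hKx).eventually (lt_mem_nhds hx)] with y hy hy'
    exact ⟨ne_of_gt hy', hy⟩
  exact Measure.measure_pos_of_mem_nhds μ hn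

lemma exists_pos_forall_frontier_lt_normSqSum {X : Type*} [TopologicalSpace X] [T2Space X]
    {K : Set X} (hK : IsCompact K) {g : X → (ι → ℂ)} (hg : ContinuousOn g K)
    (h0 : ∀ x ∈ frontier K, g x ≠ 0) : ∃ a > 0, ∀ x ∈ frontier K, a < normSqSum (g x) := by
  have hfK : frontier K ⊆ K := hK.isClosed.frontier_subset
  have hc : IsCompact (frontier K) := hK.of_isClosed_subset isClosed_frontier hfK
  have hpos : ∀ x ∈ frontier K, 0 < normSqSum (g x) := fun x hx =>
    lt_of_le_of_ne (normSqSum_nonneg _) fun h => h0 x hx (normSqSum_eq_zero.mp h.symm)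
  obtain ⟨b, hb, hlt⟩ := hc.exists_forall_le' (continuous_normSqSum.comp_continuousOn (hg.mono hfK))
    hpos
  exact ⟨b / 2, half_pos hb, fun x hx => (half_lt_self hb).trans_le (hlt x hx)⟩

variable [DecidableEq ι] {g : (ι → ℂ) → (ι → ℂ)} {K Ω : Set (ι → ℂ)} {a : ℝ}

lemma integral_cutoff_mul_jacobian_ne_zero (hK : IsCompact K) (hKΩ : K ⊆ Ω)
    (hg : AnalyticOnNhd ℂ g Ω) (k : ℕ)
    (hpos : ∃ x ∈ interior K, normSqSum (g x) < a ∧ (jacobian g x).det ≠ 0) :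
    ∫ x in K, (cutoff a k (normSqSum (g x)) : ℂ) *
      ((jacobian g x).det * conj (jacobian g x).det) ≠ 0 := by
  have hJ : ContinuousOn (fun x => (jacobian g x).det) K := fun x hx =>
    (hg x (hKΩ hx)).jacobian_det.continuousAt.continuousWithinAt
  have h := setIntegral_ofReal_ne_zero (μ := volume) hK
    (h := fun x => cutoff a k (normSqSum (g x)) * ‖(jacobian g x).det‖ ^ 2)
    ((((continuous_cutoff a k).comp continuous_normSqSum).comp_continuousOn
      (hg.continuousOn.mono hKΩ)).mul (hJ.norm.pow 2))
    (fun x _ => mul_nonneg (cutoff_nonneg _ _ _) (by positivity)) ?_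
  · simpa [Complex.mul_conj'] using h
  · obtain ⟨x, hx, hxa, hxJ⟩ := hpos
    exact ⟨x, hx, mul_pos (cutoff_pos k hxa) (by positivity)⟩

end Positivity

section Degenerate

lemma exists_analyticOnNhd_prod_add_mul {ι E : Type*} [NormedAddCommGroup E] [NormedSpace ℂ E]
    {Ω : Set E} {s : E → ℂ} {p q : ι → E → ℂ} (hs : AnalyticOnNhd ℂ s Ω)
    (hp : ∀ i, AnalyticOnNhd ℂ (p i) Ω) (hq : ∀ i, AnalyticOnNhd ℂ (q i) Ω) (S : Finset ι) :
    ∃ r : E → ℂ, AnalyticOnNhd ℂ r Ω ∧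
      ∀ x, ∏ i ∈ S, (p i x + s x * q i x) = ∏ i ∈ S, p i x + s x * r x := by
  classical
  induction S using Finset.induction_on with
  | empty => exact ⟨fun _ => 0, analyticOnNhd_const, by simp⟩
  | insert i S hi ih =>
    obtain ⟨r, hr, h⟩ := ih
    refine ⟨fun x => p i x * r x + q i x * (∏ j ∈ S, p j x) + s x * (q i x * r x),
      fun x hx => ?_, fun x => ?_⟩
    · exact (((hp i x hx).fun_mul (hr x hx)).fun_add ((hq i x hx).fun_mul
        (Finset.analyticAt_fun_prod _ fun j _ => hp j x hx))).fun_add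
          ((hs x hx).fun_mul ((hq i x hx).fun_mul (hr x hx)))
    · rw [Finset.prod_insert hi, Finset.prod_insert hi, h]
      ring

variable {ι : Type*} [Fintype ι]

lemma exists_analyticOnNhd_det_add_smul_one [DecidableEq ι] {E : Type*} [NormedAddCommGroup E]
    [NormedSpace ℂ E]
    {Ω : Set E} {s : E → ℂ} {A : E → Matrix ι ι ℂ} (hs : AnalyticOnNhd ℂ s Ω)
    (hA : ∀ i j, AnalyticOnNhd ℂ (fun x => A x i j) Ω) :
    ∃ r : E → ℂ, AnalyticOnNhd ℂ r Ω ∧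
      ∀ x, (A x + s x • (1 : Matrix ι ι ℂ)).det = (A x).det + s x * r x := by
  choose r hr h using fun σ : Equiv.Perm ι => exists_analyticOnNhd_prod_add_mul (Ω := Ω) hs
    (p := fun i x => A x (σ i) i) (q := fun i _ => (1 : Matrix ι ι ℂ) (σ i) i)
    (fun i => hA _ _) (fun i => analyticOnNhd_const) Finset.univ
  refine ⟨fun x => ∑ σ : Equiv.Perm ι, ((Equiv.Perm.sign σ : ℤ) : ℂ) * r σ x, fun x hx => ?_,
    fun x => ?_⟩
  · exact Finset.analyticAt_fun_sum _ fun σ _ => analyticAt_const.fun_mul (hr σ x hx)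
  · simp only [Matrix.det_apply', Matrix.add_apply, Matrix.smul_apply, smul_eq_mul, h, mul_add,
      Finset.sum_add_distrib, Finset.mul_sum]
    congr 1
    exact Finset.sum_congr rfl fun σ _ => by ring

/-- The one-parameter suspension `(x, s) ↦ (g x + s x, s)`. -/
def suspension (g : (ι → ℂ) → (ι → ℂ)) (X : ι ⊕ Unit → ℂ) : ι ⊕ Unit → ℂ :=
  Sum.elim (fun i => g (fun k => X (.inl k)) i + X (.inr ()) * X (.inl i)) fun _ => X (.inr ())

/-- The projection of `(x, s)` to `x`. -/
def suspensionProj : (ι ⊕ Unit → ℂ) →L[ℂ] (ι → ℂ) :=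
  ContinuousLinearMap.pi fun i => ContinuousLinearMap.proj (Sum.inl i)

lemma AnalyticAt.suspension {g : (ι → ℂ) → (ι → ℂ)} {X : ι ⊕ Unit → ℂ}
    (hg : AnalyticAt ℂ g (suspensionProj X)) : AnalyticAt ℂ (suspension g) X := by
  have hproj : ∀ c : ι ⊕ Unit, AnalyticAt ℂ (fun X : ι ⊕ Unit → ℂ => X c) X := fun c =>
    (ContinuousLinearMap.proj (R := ℂ) (φ := fun _ : ι ⊕ Unit => ℂ) c).analyticAt X
  refine AnalyticAt.pi fun c => ?_
  cases c with
  | inl i =>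
    have h1 : AnalyticAt ℂ (fun X => g (suspensionProj X)) X :=
      hg.comp (suspensionProj.analyticAt X)
    exact (analyticAt_pi_iff.mp h1 i).fun_add ((hproj _).fun_mul (hproj _))
  | inr u => exact hproj _

variable [DecidableEq ι]

lemma jacobian_suspension_det {g : (ι → ℂ) → (ι → ℂ)} {X : ι ⊕ Unit → ℂ}
    (hg : AnalyticAt ℂ g (suspensionProj X)) :
    (jacobian (suspension g) X).det =
      (jacobian g (suspensionProj X) + X (.inr ()) • (1 : Matrix ι ι ℂ)).det := by
  have hc : ∀ V c, fderiv ℂ (suspension g) X V c = fderiv ℂ (fun X => suspension g X c) X V := by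
    intro V c
    rw [(hasFDerivAt_pi'.mp hg.suspension.differentiableAt.hasFDerivAt c).fderiv]
    rfl
  have hproj : ∀ c : ι ⊕ Unit, HasFDerivAt (fun X : ι ⊕ Unit → ℂ => X c)
      (ContinuousLinearMap.proj (R := ℂ) (φ := fun _ : ι ⊕ Unit => ℂ) c) X := fun c =>
    (ContinuousLinearMap.proj (R := ℂ) (φ := fun _ : ι ⊕ Unit => ℂ) c).hasFDerivAt
  have hl : ∀ V i, fderiv ℂ (fun X => suspension g X (.inl i)) X V =
      fderiv ℂ g (suspensionProj X) (suspensionProj V) i +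
        (X (.inr ()) * V (.inl i) + X (.inl i) * V (.inr ())) := by
    intro V i
    have h1 : HasFDerivAt (fun X => g (suspensionProj X) i) _ X :=
      (hasFDerivAt_pi'.mp (hg.differentiableAt.hasFDerivAt) i).comp X suspensionProj.hasFDerivAt
    have h2 : HasFDerivAt (fun X => suspension g X (.inl i)) _ X :=
      h1.add ((hproj (.inr ())).mul (hproj (.inl i)))
    rw [h2.fderiv]
    simp
  have hr : ∀ V, fderiv ℂ (fun X => suspension g X (.inr ())) X V = V (.inr ()) := by
    intro V
    have h2 : HasFDerivAt (fun X => suspension g X (.inr ())) _ X := hproj (.inr ())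
    rw [h2.fderiv]
    rfl
  have hπl : ∀ k, suspensionProj (Pi.single (.inl k) 1 : ι ⊕ Unit → ℂ) = Pi.single k 1 := by
    intro k; ext i; simp [suspensionProj, Pi.single_apply]
  have hπr : suspensionProj (Pi.single (.inr ()) 1 : ι ⊕ Unit → ℂ) = 0 := by
    ext i; simp [suspensionProj]
  have hblock : jacobian (suspension g) X = Matrix.fromBlocks
      (jacobian g (suspensionProj X) + X (.inr ()) • (1 : Matrix ι ι ℂ)) 0
      (Matrix.of fun _ i => X (.inl i)) 1 := by
    ext (k | k) (i | i)
    · simp [jacobian, hc, hl, hπl, Matrix.one_apply, Pi.single_apply, eq_comm]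
    · simp [jacobian, hc, hr]
    · simp [jacobian, hc, hl, hπr]
    · simp [jacobian, hc, hr]
  rw [hblock, Matrix.det_fromBlocks_zero₁₂, Matrix.det_one, mul_one]

/-- The Jacobian determinant of a finite holomorphic map germ does not vanish identically. -/
theorem frequently_jacobian_det_ne_zero {g : (ι → ℂ) → (ι → ℂ)} {Ω : Set (ι → ℂ)}
    (hΩ : IsOpen Ω) (h0 : 0 ∈ Ω) (hg : AnalyticOnNhd ℂ g Ω) (hg0 : g 0 = 0)
    (hfin : ∀ x ∈ Ω, g x = 0 → x = 0) : ∃ᶠ x in 𝓝 0, (jacobian g x).det ≠ 0 := by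
  intro hJ
  simp only [not_not] at hJ
  obtain ⟨δ, hδ, hsub⟩ := Metric.nhds_basis_closedBall.mem_iff.mp (inter_mem (hΩ.mem_nhds h0) hJ)
  set K : Set (ι ⊕ Unit → ℂ) := Metric.closedBall 0 δ
  have hK : IsCompact K := isCompact_closedBall _ _
  have hπ : ∀ X ∈ K, suspensionProj X ∈ Metric.closedBall (0 : ι → ℂ) δ := by
    intro X hX
    rw [mem_closedBall_zero_iff] at hX ⊢
    exact (pi_norm_le_iff_of_nonneg hδ.le).mpr fun i => (norm_le_pi_norm X _).trans hX
  have hgK : ∀ X ∈ K, AnalyticAt ℂ g (suspensionProj X) := fun X hX => hg _ (hsub (hπ X hX)).1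
  have hG : AnalyticOnNhd ℂ (suspension g) K := fun X hX => (hgK X hX).suspension
  obtain ⟨r, hr, hdet⟩ := exists_analyticOnNhd_det_add_smul_one (Ω := K)
    (s := fun X => X (.inr ())) (A := fun X => jacobian g (suspensionProj X))
    (fun X _ => (ContinuousLinearMap.proj (R := ℂ) (φ := fun _ : ι ⊕ Unit => ℂ) _).analyticAt X)
    fun i j X hX => ((hgK X hX).jacobian_apply i j).comp (suspensionProj.analyticAt X)
  have hJG : ∀ X ∈ K, (jacobian (suspension g) X).det = suspension g X (.inr ()) * r X := by
    intro X hX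
    rw [jacobian_suspension_det (hgK X hX), hdet, (hsub (hπ X hX)).2, zero_add]
    rfl
  have hne : ∀ X ∈ frontier K, suspension g X ≠ 0 := by
    intro X hX h
    have hXK : X ∈ K := hK.isClosed.frontier_subset hX
    have hs : X (.inr ()) = 0 := congrFun h (.inr ())
    have hx : suspensionProj X = 0 := by
      refine hfin _ (hsub (hπ X hXK)).1 (funext fun i => ?_)
      have := congrFun h (.inl i)
      simpa [suspension, suspensionProj, hs] using this
    have hX0 : X = 0 := by
      ext (i | u)
      · exact congrFun hx i
      · exact hs
    have := Metric.frontier_closedBall_subset_sphere hX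
    rw [hX0, mem_sphere_zero_iff_norm, norm_zero] at this
    exact hδ.ne this
  obtain ⟨a, ha, hlt⟩ := exists_pos_forall_frontier_lt_normSqSum hK hG.continuousOn hne
  refine integral_cutoff_mul_jacobian_ne_zero (a := a) hK Subset.rfl hG 1 ?_ ?_
  · set e : ℂ → (ι ⊕ Unit → ℂ) := fun s => s • Pi.single (.inr ()) 1
    have he : Continuous e := by fun_prop
    have he0 : e 0 = 0 := by simp [e]
    have hπe : ∀ s, suspensionProj (e s) = 0 := by
      intro s; ext i; simp [suspensionProj, e]
    have hG0 : normSqSum (suspension g (e 0)) = 0 := by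
      rw [normSqSum_eq_zero, he0]
      ext (i | u)
      · have : g (fun _ => 0) i = 0 := congrFun hg0 i
        simp [suspension, this]
      · simp [suspension]
    have h1 : ∀ᶠ s in 𝓝 0, normSqSum (suspension g (e s)) < a := by
      have hcont : ContinuousAt (fun s => normSqSum (suspension g (e s))) 0 :=
        continuous_normSqSum.continuousAt.comp
          ((hG (e 0) (by simp [he0, K, hδ.le])).continuousAt.comp he.continuousAt)
      exact hcont.eventually (gt_mem_nhds (hG0.trans_lt ha))
    have h2 : ∀ᶠ s in 𝓝 0, e s ∈ interior K := by
      refine he.continuousAt.eventually_mem (isOpen_interior.mem_nhds ?_)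
      rw [he0]
      exact Metric.ball_subset_interior_closedBall (Metric.mem_ball_self hδ)
    have h3 : ∀ᶠ s in 𝓝[≠] (0 : ℂ), (jacobian g 0 + s • (1 : Matrix ι ι ℂ)).det ≠ 0 := by
      have hfinite : ((-jacobian g 0).charpoly.rootSet ℂ).Finite := Polynomial.rootSet_finite _ _
      have h4 : ∀ᶠ s in 𝓝[≠] (0 : ℂ), s ∉ ((-jacobian g 0).charpoly.rootSet ℂ) := by
        have h5 := (hfinite.sdiff (t := {0})).isClosed.isOpen_compl.mem_nhds
          (notMem_sdiff_of_mem rfl)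
        filter_upwards [mem_nhdsWithin_of_mem_nhds h5, self_mem_nhdsWithin] with s hs hs0 h
        exact hs ⟨h, hs0⟩
      filter_upwards [h4] with s hs h
      refine hs ((Polynomial.mem_rootSet_of_ne (Matrix.charpoly_monic _).ne_zero).mpr ?_)
      rw [Polynomial.coe_aeval_eq_eval, Matrix.eval_charpoly, ← h]
      congr 1
      ext i j
      simp [Matrix.scalar_apply, Matrix.diagonal_apply, Matrix.one_apply, add_comm]
    obtain ⟨s, hs1, hs2, hs3⟩ :=
      ((h1.filter_mono nhdsWithin_le_nhds).and ((h2.filter_mono nhdsWithin_le_nhds).and h3)).exists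
    refine ⟨e s, hs2, hs1, ?_⟩
    rw [jacobian_suspension_det (hgK _ (interior_subset hs2)), hπe]
    simpa [e] using hs3
  · rw [← integral_cutoff_mul_component_eq_zero hK Subset.rfl hG hr hlt one_ne_zero (.inr ())]
    exact setIntegral_congr_fun hK.measurableSet fun X hX => by simp only [hJG X hX]

end Degenerate

section Discs

variable {E : Type*} [NormedAddCommGroup E] [NormedSpace ℂ E]

/-- The iterated derivatives of `h` in the direction `e`. -/
def iteratedDirDeriv (h : E → ℂ) (e : E) : ℕ → E → ℂ
  | 0 => h
  | j + 1 => fun x => fderiv ℂ (iteratedDirDeriv h e j) x e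

lemma AnalyticOnNhd.iteratedDirDeriv {h : E → ℂ} {W : Set E} (hh : AnalyticOnNhd ℂ h W) (e : E)
    (j : ℕ) : AnalyticOnNhd ℂ (iteratedDirDeriv h e j) W := by
  induction j with
  | zero => exact hh
  | succ j ih =>
    exact fun x hx => ((ContinuousLinearMap.apply ℂ ℂ e).analyticAt _).comp (ih.fderiv x hx)

lemma AnalyticOnNhd.comp_line {h : E → ℂ} {W : Set E} (hh : AnalyticOnNhd ℂ h W) {y e : E} {ζ : ℂ}
    (hζ : y + ζ • e ∈ W) : AnalyticAt ℂ (fun t : ℂ => h (y + t • e)) ζ :=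
  have h1 : AnalyticAt ℂ (fun t : ℂ => y + t • e) ζ :=
    analyticAt_const.fun_add (analyticAt_id.fun_smul analyticAt_const)
  AnalyticAt.comp (f := fun t : ℂ => y + t • e) (hh _ hζ) h1

lemma iteratedDeriv_comp_line {h : E → ℂ} {W : Set E} (hW : IsOpen W)
    (hh : AnalyticOnNhd ℂ h W) {y e : E} (j : ℕ) {ζ : ℂ} (hζ : y + ζ • e ∈ W) :
    iteratedDeriv j (fun t : ℂ => h (y + t • e)) ζ = iteratedDirDeriv h e j (y + ζ • e) := by
  induction j generalizing ζ with
  | zero => simp [iteratedDirDeriv]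
  | succ j ih =>
    have hopen : IsOpen {t : ℂ | y + t • e ∈ W} := hW.preimage (by fun_prop)
    have heq : iteratedDeriv j (fun t : ℂ => h (y + t • e)) =ᶠ[𝓝 ζ]
        fun t => iteratedDirDeriv h e j (y + t • e) := by
      filter_upwards [hopen.mem_nhds hζ] with t ht using ih ht
    rw [iteratedDeriv_succ, heq.deriv_eq]
    have h1 : HasDerivAt (fun t : ℂ => y + t • e) e ζ := by
      simpa using ((hasDerivAt_id ζ).smul_const e).const_add y
    exact ((hh.iteratedDirDeriv e j _ hζ).differentiableAt.hasFDerivAt.comp_hasDerivAt ζ h1).deriv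

/-- A function that vanishes at an interior point of a disc together with all its derivatives along
the disc vanishes on the whole disc. -/
lemma exists_iteratedDirDeriv_eq_zero_and_ne_zero {h : E → ℂ} {W : Set E} (hW : IsOpen W)
    (hh : AnalyticOnNhd ℂ h W) {y e : E} (hdisc : ∀ ζ : ℂ, ‖ζ‖ ≤ 1 → y + ζ • e ∈ W)
    (hne : h (y + e) ≠ 0) {ζ : ℂ} (hζ : ‖ζ‖ ≤ 1) (h0 : h (y + ζ • e) = 0) :
    ∃ j, iteratedDirDeriv h e j (y + ζ • e) = 0 ∧
      iteratedDirDeriv h e (j + 1) (y + ζ • e) ≠ 0 := by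
  by_contra! hcon
  have hall : ∀ j, iteratedDirDeriv h e j (y + ζ • e) = 0 := fun j => by
    induction j with
    | zero => exact h0
    | succ j ih => exact hcon j ih
  have hk : AnalyticOnNhd ℂ (fun t : ℂ => h (y + t • e)) (Metric.closedBall 0 1) :=
    fun t ht => hh.comp_line (hdisc t (by simpa using ht))
  have hζ' : ζ ∈ Metric.closedBall (0 : ℂ) 1 := by simpa using hζ
  have htop : analyticOrderAt (fun t : ℂ => h (y + t • e)) ζ = ⊤ :=
    ENat.eq_top_iff_forall_ge.mpr fun m =>
      (natCast_le_analyticOrderAt_iff_iteratedDeriv_eq_zero (hk ζ hζ')).mpr fun i _ => by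
        rw [iteratedDeriv_comp_line hW hh i (hdisc ζ hζ), hall]
  have hz := hk.eqOn_zero_of_preconnected_of_eventuallyEq_zero
    (convex_closedBall (0 : ℂ) 1).isPreconnected hζ' (analyticOrderAt_eq_top.mp htop)
  exact hne (by simpa using hz (show (1 : ℂ) ∈ Metric.closedBall (0 : ℂ) 1 by simp))

lemma exists_ball_line_injective {ψ : E → ℂ} {W : Set E} {z e : E} (hW : W ∈ 𝓝 z)
    (hψ : AnalyticAt ℂ ψ z) (he : fderiv ℂ ψ z e ≠ 0) :
    ∃ ε > 0, Metric.ball z ε ⊆ W ∧ ∀ x ∈ Metric.ball z ε, ∀ ζ : ℂ, x + ζ • e ∈ Metric.ball z ε →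
      ψ x = 0 → ψ (x + ζ • e) = 0 → ζ = 0 := by
  have hd : 0 < ‖fderiv ℂ ψ z e‖ := norm_pos_iff.mpr he
  set c := ‖fderiv ℂ ψ z e‖ / (2 * (‖e‖ + 1))
  have hc : 0 < c := by positivity
  have hce : c * ‖e‖ < ‖fderiv ℂ ψ z e‖ := by
    have h1 : c * (2 * (‖e‖ + 1)) = ‖fderiv ℂ ψ z e‖ := div_mul_cancel₀ _ (by positivity)
    nlinarith [norm_nonneg e]
  have hev := hψ.hasStrictFDerivAt.isLittleO.def hc
  rw [nhds_prod_eq] at hev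
  obtain ⟨T, hT, hTT⟩ := mem_prod_same_iff.mp hev
  obtain ⟨ε, hε, hsub⟩ := Metric.nhds_basis_ball.mem_iff.mp (inter_mem hW hT)
  refine ⟨ε, hε, fun x hx => (hsub hx).1, fun x hx ζ hx' h0 h0' => ?_⟩
  by_contra hζ
  have h2 := hTT (mk_mem_prod (hsub hx').2 (hsub hx).2)
  simp only [mem_ofPred_eq, h0, h0', add_sub_cancel_left, map_smul, sub_self, zero_sub, norm_neg,
    norm_smul] at h2
  have h3 : 0 < ‖ζ‖ := norm_pos_iff.mpr hζ
  nlinarith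

lemma exists_transverse_disc {h : E → ℂ} {W : Set E} (hW : W ∈ 𝓝 0) (hh : AnalyticOnNhd ℂ h W)
    (h0 : h 0 = 0) (hne : ∃ᶠ x in 𝓝 0, h x ≠ 0) :
    ∃ e ≠ (0 : E), ∃ δ > 0, ∀ᶠ y in 𝓝 0, (∀ ζ : ℂ, ‖ζ‖ ≤ 1 → y + ζ • e ∈ W) ∧
      ∀ ζ : ℂ, ‖ζ‖ = 1 → δ ≤ ‖h (y + ζ • e)‖ := by
  obtain ⟨ε, hε, hsub⟩ := Metric.nhds_basis_ball.mem_iff.mp hW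
  obtain ⟨e₀, he₀, hne₀⟩ := (hne.and_eventually (Metric.ball_mem_nhds 0 hε)).exists.imp
    fun _ h => h.symm
  have hmem : ∀ t : ℂ, ‖t‖ ≤ 1 → t • e₀ ∈ Metric.ball (0 : E) ε := by
    intro t ht
    rw [mem_ball_zero_iff, norm_smul]
    exact (mul_le_of_le_one_left (norm_nonneg _) ht).trans_lt (mem_ball_zero_iff.mp he₀)
  have hk : AnalyticOnNhd ℂ (fun t : ℂ => h (0 + t • e₀)) (Metric.closedBall 0 1) :=
    fun t ht => hh.comp_line (by simpa using hsub (hmem t (by simpa using ht)))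
  have hiso : ∀ᶠ t in 𝓝[≠] (0 : ℂ), h (0 + t • e₀) ≠ 0 := by
    refine (hk 0 (by simp)).eventually_eq_zero_or_eventually_ne_zero.resolve_left fun hz => hne₀ ?_
    have := hk.eqOn_zero_of_preconnected_of_eventuallyEq_zero
      (convex_closedBall (0 : ℂ) 1).isPreconnected (by simp) hz
    simpa using this (show (1 : ℂ) ∈ Metric.closedBall (0 : ℂ) 1 by simp)
  obtain ⟨ρ, hρ, hρs⟩ := Metric.nhds_basis_ball.mem_iff.mp (mem_nhdsWithin_iff_eventually.mp hiso)
  set τ : ℝ := min (ρ / 2) 1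
  have hτ : 0 < τ := by positivity
  have hτρ : τ < ρ := (min_le_left _ _).trans_lt (half_lt_self hρ)
  set e : E := (τ : ℂ) • e₀
  have hnorm : ∀ ζ : ℂ, ‖ζ * τ‖ = ‖ζ‖ * τ := fun ζ => by
    rw [norm_mul, Complex.norm_real, Real.norm_of_nonneg hτ.le]
  have hline : ∀ ζ : ℂ, ζ • e = (ζ * τ) • e₀ := fun ζ => smul_smul _ _ _
  have hball : ∀ ζ : ℂ, ‖ζ‖ ≤ 1 → ζ • e ∈ Metric.ball (0 : E) ε := fun ζ hζ => by
    rw [hline]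
    refine hmem _ ?_
    rw [hnorm]
    exact mul_le_one₀ hζ hτ.le (min_le_right _ _)
  have hcirc : ∀ ζ : ℂ, ‖ζ‖ = 1 → h (ζ • e) ≠ 0 := fun ζ hζ => by
    have hn := hnorm ζ
    rw [hζ, one_mul] at hn
    have := hρs (show ζ * τ ∈ Metric.ball (0 : ℂ) ρ by rw [mem_ball_zero_iff, hn]; exact hτρ)
      (fun h => hτ.ne (by rw [← hn, h, norm_zero]))
    rw [hline]
    simpa using this
  have he : e ≠ 0 := fun he => hcirc 1 norm_one (by rw [he, smul_zero, h0])
  have hcont : ∀ ζ : ℂ, ‖ζ‖ ≤ 1 → ContinuousAt (fun p : E × ℂ => h (p.1 + p.2 • e)) (0, ζ) := by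
    intro ζ hζ
    refine ContinuousAt.comp (g := h) ?_ (by fun_prop)
    simpa using (hh _ (hsub (hball ζ hζ))).continuousAt
  have hsphere : IsCompact (Metric.sphere (0 : ℂ) 1) := isCompact_sphere _ _
  obtain ⟨b, hb, hlt⟩ := hsphere.exists_forall_le' (f := fun ζ => ‖h (ζ • e)‖) (a := 0)
    (fun ζ hζ => by
      have h1 := hh _ (hsub (hball ζ (by simpa using (mem_sphere_zero_iff_norm.mp hζ).le)))
      exact (h1.continuousAt.comp (f := fun ζ : ℂ => ζ • e)
        (by fun_prop)).norm.continuousWithinAt)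
    (fun ζ hζ => norm_pos_iff.mpr (hcirc ζ (by simpa using hζ)))
  refine ⟨e, he, b / 2, half_pos hb, ?_⟩
  have hE1 : ∀ᶠ y in 𝓝 (0 : E), ∀ ζ ∈ Metric.closedBall (0 : ℂ) 1, y + ζ • e ∈ W := by
    refine (isCompact_closedBall (0 : ℂ) 1).eventually_forall_of_forall_eventually
      (P := fun y ζ => y + ζ • e ∈ W) fun ζ hζ => ?_
    have h1 : ContinuousAt (fun p : E × ℂ => p.1 + p.2 • e) (0, ζ) := by fun_prop
    refine h1.eventually_mem (mem_of_superset (Metric.isOpen_ball.mem_nhds ?_) hsub)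
    simpa using hball ζ (by simpa using hζ)
  have hE2 : ∀ᶠ y in 𝓝 (0 : E), ∀ ζ ∈ Metric.sphere (0 : ℂ) 1, b / 2 ≤ ‖h (y + ζ • e)‖ := by
    refine hsphere.eventually_forall_of_forall_eventually
      (P := fun y ζ => b / 2 ≤ ‖h (y + ζ • e)‖) fun ζ hζ => ?_
    have h1 := (hcont ζ (mem_sphere_zero_iff_norm.mp hζ).le).norm
    refine (h1.eventually (lt_mem_nhds (a := b / 2) ?_)).mono fun p hp => le_of_lt hp
    simpa using (half_lt_self hb).trans_le (hlt ζ hζ)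
  filter_upwards [hE1, hE2] with y hy1 hy2
  exact ⟨fun ζ hζ => hy1 ζ (by simpa using hζ), fun ζ hζ => hy2 ζ (by simpa using hζ)⟩

variable [ProperSpace E] {F : Type*} [NormedAddCommGroup F]

/-- Discs transverse to a function vanishing on a set of codimension at least two can be moved
off that set. -/
lemma frequently_forall_disc_ne_zero {h : E → ℂ} {ω : E → F} {W : Set E} (hW : IsOpen W)
    (hh : AnalyticOnNhd ℂ h W) (hω : ContinuousOn ω W) (hωh : ∀ x ∈ W, ω x = 0 → h x = 0)
    (hcodim : ¬ ∃ (q : E) (V : Set E) (ψ : E → ℂ), IsOpen V ∧ IsPreconnected V ∧ q ∈ V ∧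
      AnalyticOnNhd ℂ ψ V ∧ ψ q = 0 ∧ (∃ x ∈ V, ψ x ≠ 0) ∧
        {x ∈ V | ψ x = 0} ⊆ {x ∈ W | ω x = 0}) {e : E}
    (hdisc : ∀ᶠ y in 𝓝 0, (∀ ζ : ℂ, ‖ζ‖ ≤ 1 → y + ζ • e ∈ W) ∧ h (y + e) ≠ 0) :
    ∃ᶠ y in 𝓝 0, ∀ ζ : ℂ, ‖ζ‖ ≤ 1 → ω (y + ζ • e) ≠ 0 := by
  intro hmeet
  obtain ⟨r, hr, hrs⟩ := Metric.nhds_basis_ball.mem_iff.mp (hdisc.and hmeet)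
  have hloc : ∀ j, ∀ z ∈ {z ∈ W | iteratedDirDeriv h e j z = 0 ∧
      iteratedDirDeriv h e (j + 1) z ≠ 0}, ∃ ε > 0, Metric.ball z ε ⊆ W ∧
      ∀ x ∈ Metric.ball z ε, ∀ ζ : ℂ, x + ζ • e ∈ Metric.ball z ε →
        iteratedDirDeriv h e j x = 0 → iteratedDirDeriv h e j (x + ζ • e) = 0 → ζ = 0 :=
    fun j z hz => exists_ball_line_injective (hW.mem_nhds hz.1) (hh.iteratedDirDeriv e j z hz.1)
      hz.2.2
  choose! ε hε hεW hinj using hloc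
  have hcover := fun j => TopologicalSpace.countable_cover_nhdsWithin
    (f := fun z => Metric.closedBall z (ε j z / 2)) (s := {z ∈ W | iteratedDirDeriv h e j z = 0 ∧
      iteratedDirDeriv h e (j + 1) z ≠ 0}) fun z hz =>
    mem_nhdsWithin_of_mem_nhds (Metric.closedBall_mem_nhds z (half_pos (hε j z hz)))
  choose t htsub htc htcover using hcover
  have hball : ∀ j, ∀ z ∈ t j, Metric.closedBall z (ε j z / 2) ⊆ Metric.ball z (ε j z) :=
    fun j z hz => Metric.closedBall_subset_ball (half_lt_self (hε j z (htsub j hz)))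
  set D : (Σ j, t j) → Set E := fun i => Metric.closedBall i.2.1 (ε i.1 i.2.1 / 2) ∩
    (fun x => (ω x, iteratedDirDeriv h e i.1 x)) ⁻¹' {0}
  have hDc : ∀ i, IsCompact (D i) := by
    rintro ⟨j, z, hz⟩
    have hcont : ContinuousOn (fun x => (ω x, iteratedDirDeriv h e j x))
        (Metric.closedBall z (ε j z / 2)) := by
      have hsub := (hball j z hz).trans (hεW j z (htsub j hz))
      exact (hω.mono hsub).prodMk ((hh.iteratedDirDeriv e j).continuousOn.mono hsub)
    exact (isCompact_closedBall _ _).of_isClosed_subset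
      (hcont.preimage_isClosed_of_isClosed Metric.isClosed_closedBall isClosed_singleton)
      inter_subset_left
  set G : (Σ j, t j) → Set E := fun i =>
    (fun p : E × ℂ => p.1 - p.2 • e) '' (D i ×ˢ Metric.closedBall 0 1)
  have hGc : ∀ i, IsClosed (G i) := fun i =>
    (((hDc i).prod (isCompact_closedBall _ _)).image (by fun_prop)).isClosed
  have : ∀ j, Countable (t j) := fun j => (htc j).to_subtype
  have hGy : ∀ y ∈ Metric.ball 0 r, ∃ i, y ∈ G i := fun y hy => by
    obtain ⟨⟨hyW, hy1⟩, hyω⟩ := hrs hy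
    push Not at hyω
    obtain ⟨ζ, hζ, h0⟩ := hyω
    obtain ⟨j, hj, hj'⟩ := exists_iteratedDirDeriv_eq_zero_and_ne_zero hW hh hyW hy1 hζ
      (hωh _ (hyW ζ hζ) h0)
    obtain ⟨z, hz, hyz⟩ := mem_iUnion₂.mp (htcover j ⟨hyW ζ hζ, hj, hj'⟩)
    exact ⟨⟨j, z, hz⟩, (y + ζ • e, ζ),
      ⟨⟨hyz, Prod.mk_eq_zero.mpr ⟨h0, hj⟩⟩, by simpa using hζ⟩, by simp⟩
  have hdense := dense_iUnion_interior_of_closed (f := fun i => G i ∪ (Metric.ball 0 r)ᶜ)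
    (fun i => (hGc i).union Metric.isOpen_ball.isClosed_compl) ?_
  · obtain ⟨y₀, hy₀, hy₀r⟩ := hdense.exists_mem_open Metric.isOpen_ball
      ⟨(0 : E), Metric.mem_ball_self hr⟩
    obtain ⟨⟨j, z, hz⟩, hi⟩ := mem_iUnion.mp hy₀
    have hG : G ⟨j, z, hz⟩ ∈ 𝓝 y₀ := by
      filter_upwards [mem_interior_iff_mem_nhds.mp hi, Metric.isOpen_ball.mem_nhds hy₀r]
        with y hy hyr using hy.resolve_right (not_not.mpr hyr)
    obtain ⟨⟨q, ζ₀⟩, ⟨hq, -⟩, hqy⟩ := mem_of_mem_nhds hG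
    have hinj' := hinj j z (htsub j hz)
    have hωψ : ∀ x ∈ D ⟨j, z, hz⟩, ω x = 0 ∧ iteratedDirDeriv h e j x = 0 :=
      fun x hx => Prod.mk_eq_zero.mp hx.2
    have hnear : Metric.ball z (ε j z) ∩ (fun x => x - ζ₀ • e) ⁻¹' G ⟨j, z, hz⟩ ∈ 𝓝 q := by
      refine inter_mem (Metric.isOpen_ball.mem_nhds (hball j z hz hq.1)) ?_
      refine ContinuousAt.preimage_mem_nhds (by fun_prop) ?_
      rw [show q - ζ₀ • e = y₀ from hqy]
      exact hG
    obtain ⟨s, hs, hsub⟩ := Metric.nhds_basis_ball.mem_iff.mp hnear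
    refine hcodim ⟨q, Metric.ball q s, iteratedDirDeriv h e j, Metric.isOpen_ball,
      (convex_ball q s).isPreconnected, Metric.mem_ball_self hs,
      (hh.iteratedDirDeriv e j).mono fun x hx => hεW j z (htsub j hz) (hsub hx).1,
      (hωψ q hq).2, ?_, ?_⟩
    · have hline : ∀ᶠ τ in 𝓝 (0 : ℂ), q + τ • e ∈ Metric.ball q s := by
        have h1 : ContinuousAt (fun τ : ℂ => q + τ • e) 0 := by fun_prop
        exact h1.eventually_mem (Metric.isOpen_ball.mem_nhds (by simpa using hs))
      obtain ⟨τ, hτs, hτ⟩ := ((hline.filter_mono nhdsWithin_le_nhds).and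
        (self_mem_nhdsWithin : ∀ᶠ τ in 𝓝[≠] (0 : ℂ), τ ∈ ({0}ᶜ : Set ℂ))).exists
      exact ⟨_, hτs, fun h0 => hτ (hinj' q (hball j z hz hq.1) τ (hsub hτs).1 (hωψ q hq).2 h0)⟩
    · rintro x ⟨hxs, hx0⟩
      obtain ⟨⟨x', ζ'⟩, ⟨hx', -⟩, hxx⟩ := (hsub hxs).2
      have hx'eq : x' = x + (ζ' - ζ₀) • e := by
        rw [sub_smul, add_sub_left_comm, ← sub_eq_iff_eq_add']
        exact hxx
      have hζ := hinj' x (hsub hxs).1 (ζ' - ζ₀) (hx'eq ▸ hball j z hz hx'.1) hx0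
        (hx'eq ▸ (hωψ x' hx').2)
      rw [hζ, zero_smul, add_zero] at hx'eq
      exact ⟨hεW j z (htsub j hz) (hsub hxs).1, hx'eq ▸ (hωψ x' hx').1⟩
  · refine eq_univ_of_forall fun y => mem_iUnion.mpr ?_
    by_cases hy : y ∈ Metric.ball 0 r
    · exact (hGy y hy).imp fun _ h => Or.inl h
    · exact (hGy 0 (Metric.mem_ball_self hr)).imp fun _ _ => Or.inr hy

end Discs

section Division

/-- Two proportional families of holomorphic functions on the closed unit disc, the first one
without common zeros, satisfy a bound for the ratio given by the maximum principle. -/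
lemma norm_le_mul_of_proportional {ι : Type*} {w H : ι → ℂ → ℂ}
    (hw : ∀ k, DifferentiableOn ℂ (w k) (Metric.closedBall 0 1))
    (hH : ∀ k, DifferentiableOn ℂ (H k) (Metric.closedBall 0 1))
    (hprop : ∀ t ∈ Metric.closedBall (0 : ℂ) 1, ∀ j k, w k t * H j t = w j t * H k t)
    (hne : ∀ t ∈ Metric.closedBall (0 : ℂ) 1, ∃ k, w k t ≠ 0) {a : ι} {δ C : ℝ} (hδ : 0 < δ)
    (hwa : ∀ t ∈ Metric.sphere (0 : ℂ) 1, δ ≤ ‖w a t‖)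
    (hHa : ∀ t ∈ Metric.sphere (0 : ℂ) 1, ‖H a t‖ ≤ C) (j : ι) :
    ‖H j 0‖ ≤ C / δ * ‖w j 0‖ := by
  have hratio : ∀ t ∈ Metric.closedBall (0 : ℂ) 1, ∃ u : ℂ, ∀ j, H j t = u * w j t := by
    intro t ht
    obtain ⟨k, hk⟩ := hne t ht
    refine ⟨H k t / w k t, fun j => ?_⟩
    field_simp
    linear_combination hprop t ht j k
  choose! u hu using hratio
  have hdiff : DifferentiableOn ℂ u (Metric.closedBall 0 1) := by
    intro t ht
    obtain ⟨k, hk⟩ := hne t ht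
    have heq : ∀ s ∈ Metric.closedBall (0 : ℂ) 1, w k s ≠ 0 → u s = H k s / w k s :=
      fun s hs hks => by rw [hu s hs k, mul_div_cancel_right₀ _ hks]
    refine ((hH k t ht).div (hw k t ht) hk).congr_of_eventuallyEq ?_ (heq t ht hk)
    filter_upwards [(hw k t ht).continuousWithinAt.eventually_ne hk, self_mem_nhdsWithin]
      with s hs hs' using heq s hs' hs
  have h0 : (0 : ℂ) ∈ Metric.closedBall (0 : ℂ) 1 := by simp
  have hbound : ‖u 0‖ ≤ C / δ := by
    refine Complex.norm_le_of_forall_mem_frontier_norm_le (Metric.isBounded_ball (x := (0 : ℂ))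
      (r := 1)) (DiffContOnCl.mk_ball (hdiff.mono Metric.ball_subset_closedBall)
      hdiff.continuousOn) ?_ (subset_closure (Metric.mem_ball_self one_pos))
    intro t ht
    rw [frontier_ball _ one_ne_zero] at ht
    have h1 := hHa t ht
    rw [hu t (Metric.sphere_subset_closedBall ht) a, norm_mul] at h1
    rw [le_div_iff₀ hδ]
    exact (mul_le_mul_of_nonneg_left (hwa t ht) (norm_nonneg _)).trans h1
  rw [hu 0 h0 j, norm_mul]
  exact mul_le_mul_of_nonneg_right hbound (norm_nonneg _)

variable {E : Type*} [NormedAddCommGroup E] [NormedSpace ℂ E] [ProperSpace E]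

/-- A function `N` such that `N w` is a combination of the components of `w`, with coefficients
that are proportional to `w`, vanishes where `w` does if the zeros of `w` have codimension at least
two. -/
lemma eq_zero_of_proportional {ι : Type*} [Fintype ι] {W : Set E} (hW : IsOpen W) (h0W : 0 ∈ W)
    {w : ι → E → ℂ} (hw : ∀ i, AnalyticOnNhd ℂ (w i) W) (hw0 : ∀ i, w i 0 = 0) {a : ι}
    (hne : ∃ᶠ x in 𝓝 0, w a x ≠ 0)
    (hcodim : ¬ ∃ (q : E) (V : Set E) (ψ : E → ℂ), IsOpen V ∧ IsPreconnected V ∧ q ∈ V ∧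
      AnalyticOnNhd ℂ ψ V ∧ ψ q = 0 ∧ (∃ x ∈ V, ψ x ≠ 0) ∧
        {x ∈ V | ψ x = 0} ⊆ {x ∈ W | (fun i => w i x) = 0})
    {H : ι → ι → E → ℂ} {N : E → ℂ} (hN : ContinuousAt N 0)
    (hH : ∀ᶠ y in 𝓝 0, ∀ i j, DifferentiableAt ℂ (H i j) y)
    (hprop : ∀ᶠ y in 𝓝 0, ∀ i j k, w k y * H i j y = w j y * H i k y)
    (hsum : ∀ᶠ y in 𝓝 0, ∀ j, ∑ i, w i y * H i j y = w j y * N y) : N 0 = 0 := by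
  set C : ℝ := ∑ i, (‖H i a 0‖ + 1)
  have hC : ∀ᶠ y in 𝓝 0, ∀ i, ‖H i a y‖ ≤ C := by
    refine eventually_all.mpr fun i => ?_
    have hc : ContinuousAt (fun y => ‖H i a y‖) 0 := (hH.self_of_nhds i a).continuousAt.norm
    filter_upwards [hc.eventually (gt_mem_nhds (lt_add_one _))] with y hy
    exact hy.le.trans (Finset.single_le_sum (f := fun i => ‖H i a 0‖ + 1)
      (fun i _ => by positivity) (Finset.mem_univ i))
  have hS : {y | y ∈ W ∧ (∀ i j, DifferentiableAt ℂ (H i j) y) ∧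
      (∀ i j k, w k y * H i j y = w j y * H i k y) ∧ ∀ i, ‖H i a y‖ ≤ C} ∈ 𝓝 (0 : E) :=
    inter_mem (hW.mem_nhds h0W) (hH.and (hprop.and hC))
  obtain ⟨e, -, δ, hδ, hdisc⟩ := exists_transverse_disc hS ((hw a).mono fun y hy => hy.1) (hw0 a)
    hne
  have hfreq := frequently_forall_disc_ne_zero (ω := fun x i => w i x) (e := e) hW (hw a)
    (continuousOn_pi.mpr fun i => (hw i).continuousOn) (fun x _ hx => congrFun hx a) hcodim
    (hdisc.mono fun y hy => ⟨fun ζ hζ => (hy.1 ζ hζ).1, norm_pos_iff.mp (hδ.trans_le (by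
      simpa using hy.2 1 norm_one))⟩)
  have hbound : ∃ᶠ y in 𝓝 0, ‖N y‖ ≤ C / δ * ∑ i, ‖w i y‖ := by
    refine (hfreq.and_eventually (hdisc.and hsum)).mono ?_
    rintro y ⟨hy, ⟨hyS, hyδ⟩, hys⟩
    obtain ⟨j, hj⟩ : ∃ j, w j y ≠ 0 := by
      simpa using Function.ne_iff.mp (hy 0 (by simp))
    have hline : ∀ t : ℂ, DifferentiableAt ℂ (fun t : ℂ => y + t • e) t := fun t => by fun_prop
    have hHj : ∀ i, ‖H i j y‖ ≤ C / δ * ‖w j y‖ := fun i => by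
      have := norm_le_mul_of_proportional (w := fun k t => w k (y + t • e))
        (H := fun k t => H i k (y + t • e)) (a := a) (δ := δ) (C := C)
        (fun k t ht => ((hw k _ (hyS t (by simpa using ht)).1).differentiableAt.comp t
          (hline t)).differentiableWithinAt)
        (fun k t ht => (((hyS t (by simpa using ht)).2.1 i k).comp t
          (hline t)).differentiableWithinAt)
        (fun t ht j k => (hyS t (by simpa using ht)).2.2.1 i j k)
        (fun t ht => Function.ne_iff.mp (hy t (by simpa using ht))) hδ
        (fun t ht => hyδ t (by simpa using ht))
        (fun t ht => (hyS t (mem_sphere_zero_iff_norm.mp ht).le).2.2.2 i) j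
      simpa using this
    have h1 : ‖w j y‖ * ‖N y‖ ≤ ‖w j y‖ * (C / δ * ∑ i, ‖w i y‖) := by
      calc ‖w j y‖ * ‖N y‖ = ‖∑ i, w i y * H i j y‖ := by rw [hys j, norm_mul]
        _ ≤ ∑ i, ‖w i y‖ * (C / δ * ‖w j y‖) := by
          refine (norm_sum_le _ _).trans (Finset.sum_le_sum fun i _ => ?_)
          rw [norm_mul]
          exact mul_le_mul_of_nonneg_left (hHj i) (norm_nonneg _)
        _ = _ := by
          rw [← Finset.sum_mul]
          ring
    exact le_of_mul_le_mul_left h1 (norm_pos_iff.mpr hj)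
  by_contra hN0
  have hcont : ContinuousAt (fun y => ‖N y‖ - C / δ * ∑ i, ‖w i y‖) 0 :=
    hN.norm.sub (continuousAt_const.mul (tendsto_finsetSum _ fun i _ =>
      (hw i 0 h0W).continuousAt.norm))
  have hev := hcont.eventually (lt_mem_nhds (a := 0) (by simpa [hw0] using hN0))
  obtain ⟨y, hy, hy'⟩ := (hbound.and_eventually hev).exists
  linarith

end Division

section Trace

variable {ι : Type*} [Fintype ι] [DecidableEq ι] {g : (ι → ℂ) → (ι → ℂ)} {K Ω : Set (ι → ℂ)}
  {a : ℝ} {y : ι → ℂ}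

lemma fiberTrace_congr (hK : IsCompact K) {φ φ' : (ι → ℂ) → ℂ} (h : EqOn φ φ' K) :
    fiberTrace g K a φ y = fiberTrace g K a φ' y :=
  setIntegral_congr_fun hK.measurableSet fun x hx => by simp only [h hx]

lemma fiberTrace_sum (hK : IsCompact K) (hKΩ : K ⊆ Ω) (hg : AnalyticOnNhd ℂ g Ω) {κ : Type*}
    (s : Finset κ) {φ : κ → (ι → ℂ) → ℂ} (hφ : ∀ i ∈ s, ContinuousOn (φ i) K) :
    fiberTrace g K a (fun x => ∑ i ∈ s, φ i x) y = ∑ i ∈ s, fiberTrace g K a (φ i) y := by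
  simp only [fiberTrace, Finset.sum_mul, Finset.mul_sum]
  refine integral_finsetSum _ fun i hi => ContinuousOn.integrableOn_compact hK ?_
  have h1 : ContinuousOn (fun x => (cutoff a 2 (normSqSum (g x - y)) : ℂ)) K :=
    (Complex.continuous_ofReal.comp ((continuous_cutoff a 2).comp
      continuous_normSqSum)).comp_continuousOn
        ((hg.continuousOn.mono hKΩ).sub continuousOn_const)
  exact h1.mul (continuousOn_mul_conj_jacobian hKΩ hg (hφ i hi))

lemma AnalyticAt.jacobian_adjugate {x : ι → ℂ} (hg : AnalyticAt ℂ g x) (i j : ι) :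
    AnalyticAt ℂ (fun y => (jacobian g y).adjugate i j) x := by
  simp only [Matrix.adjugate_apply]
  refine AnalyticAt.matrix_det fun k l => ?_
  by_cases hk : k = j
  · simpa [hk] using analyticAt_const
  · simpa [Matrix.updateRow_ne hk] using hg.jacobian_apply k l

/-- If the determinant of the Jacobian times `w ∘ g` is divisible by a combination of the components
of `w ∘ g` and the zeros of `w` have codimension at least two, then the trace of the Jacobian
determinant vanishes at the zeros of `w`. -/
lemma fiberTrace_jacobian_det_eq_zero (hΩ : IsOpen Ω) (hΩc : IsPreconnected Ω)
    (hg : AnalyticOnNhd ℂ g Ω) (hK : IsCompact K) (hKΩ : K ⊆ Ω)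
    (ha : ∀ᶠ y in 𝓝 0, ∀ x ∈ frontier K, a < normSqSum (g x - y)) {R : ℝ} (hR : 0 < R)
    (hgR : MapsTo g Ω (Metric.ball 0 R)) {W : Set (ι → ℂ)} (hW : IsOpen W)
    (hRW : Metric.ball 0 (5 * R) ⊆ W) {w : ι → (ι → ℂ) → ℂ} (hw : ∀ i, AnalyticOnNhd ℂ (w i) W)
    (hw0 : ∀ i, w i 0 = 0) (hne : ∃ i, ∃ᶠ x in 𝓝 0, w i x ≠ 0)
    (hcodim : ¬ ∃ (q : ι → ℂ) (V : Set (ι → ℂ)) (ψ : (ι → ℂ) → ℂ), IsOpen V ∧ IsPreconnected V ∧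
      q ∈ V ∧ AnalyticOnNhd ℂ ψ V ∧ ψ q = 0 ∧ (∃ x ∈ V, ψ x ≠ 0) ∧
        {x ∈ V | ψ x = 0} ⊆ {x ∈ W | (fun i => w i x) = 0})
    {f : (ι → ℂ) → ℂ} {θ c : ι → (ι → ℂ) → ℂ} (hf : AnalyticOnNhd ℂ f Ω)
    (hθ : ∀ j, AnalyticOnNhd ℂ (θ j) Ω) (hc : ∀ i, AnalyticOnNhd ℂ (c i) Ω)
    (hJ : ∀ x ∈ Ω, ∀ j, w j (g x) * (jacobian g x).det = f x * θ j x)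
    (hfc : ∀ x ∈ Ω, f x = ∑ i, w i (g x) * c i x) :
    fiberTrace g K a (fun x => (jacobian g x).det) 0 = 0 := by
  by_contra hN0
  have hball : ∀ᶠ y in 𝓝 (0 : ι → ℂ), y ∈ Metric.ball 0 R := Metric.ball_mem_nhds 0 hR
  have hdet : AnalyticOnNhd ℂ (fun x => (jacobian g x).det) Ω := fun x hx => (hg x hx).jacobian_det
  have hlin : ∀ φ, AnalyticOnNhd ℂ φ Ω → ∀ᶠ y in 𝓝 0, ∀ i,
      fiberTrace g K a (fun x => w i (g x) * φ x) y = w i y * fiberTrace g K a φ y := by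
    intro φ hφ
    filter_upwards [ha, hball] with y hy hyR i
    exact fiberTrace_comp_mul hK hKΩ hg hφ hy ((hw i).mono hRW) hgR hyR
  have hNc : ContinuousAt (fiberTrace g K a fun x => (jacobian g x).det) 0 :=
    (differentiableAt_fiberTrace hK hKΩ hg hdet ha.self_of_nhds).continuousAt
  have hwg : ∀ i, AnalyticOnNhd ℂ (fun x => w i (g x)) Ω := fun i x hx =>
    AnalyticAt.comp (hw i _ (hRW (Metric.ball_subset_ball (by linarith) (hgR hx)))) (hg x hx)
  obtain ⟨x₁, hx₁, hfx₁⟩ : ∃ x ∈ Ω, f x ≠ 0 := by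
    by_contra! hfz
    obtain ⟨i, hi⟩ := hne
    refine hi ?_
    filter_upwards [hlin _ hdet, hNc.eventually_ne hN0] with y hy hyN
    have h1 : fiberTrace g K a (fun x => w i (g x) * (jacobian g x).det) y = 0 := by
      rw [fiberTrace_congr hK (φ' := fun _ => 0) fun x hx => ?_]
      · simp [fiberTrace]
      · simp only
        rw [hJ x (hKΩ hx) i, hfz x (hKΩ hx), zero_mul]
    rw [hy i] at h1
    exact not_not.mpr ((mul_eq_zero.mp h1).resolve_right hyN)
  have hcross : ∀ x ∈ Ω, ∀ j k, w k (g x) * θ j x = w j (g x) * θ k x := by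
    intro x hx j k
    have han : AnalyticOnNhd ℂ (fun x => w k (g x) * θ j x - w j (g x) * θ k x) Ω :=
      ((hwg k).mul (hθ j)).sub ((hwg j).mul (hθ k))
    have hz : (fun x => w k (g x) * θ j x - w j (g x) * θ k x) =ᶠ[𝓝 x₁] 0 := by
      filter_upwards [(hf x₁ hx₁).continuousAt.eventually_ne hfx₁,
        hΩ.mem_nhds hx₁] with x hfx hx
      refine (mul_eq_zero.mp (?_ : f x * _ = 0)).resolve_left hfx
      linear_combination w j (g x) * hJ x hx k - w k (g x) * hJ x hx j
    exact sub_eq_zero.mp (han.eqOn_zero_of_preconnected_of_eventuallyEq_zero hΩc hx₁ hz hx)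
  obtain ⟨i₀, hi₀⟩ := hne
  refine hN0 (eq_zero_of_proportional hW (hRW (Metric.mem_ball_self (by positivity))) hw hw0 hi₀
    hcodim (H := fun i j => fiberTrace g K a fun x => c i x * θ j x) hNc ?_ ?_ ?_)
  · filter_upwards [ha] with y hy i j
    exact differentiableAt_fiberTrace hK hKΩ hg ((hc i).mul (hθ j)) hy
  · refine eventually_all.mpr fun i => eventually_all.mpr fun j => eventually_all.mpr fun k => ?_
    filter_upwards [hlin _ ((hc i).mul (hθ j)), hlin _ ((hc i).mul (hθ k))] with y h1 h2
    refine (h1 k).symm.trans (Eq.trans (fiberTrace_congr hK fun x hx => ?_) (h2 j))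
    have := hcross x (hKΩ hx) j k
    linear_combination c i x * this
  · refine eventually_all.mpr fun j => ?_
    filter_upwards [hlin _ hdet, eventually_all.mpr fun i => hlin _ ((hc i).mul (hθ j))]
      with y h1 h2
    refine Eq.trans ?_ (h1 j)
    refine (Finset.sum_congr rfl fun i _ => (h2 i i).symm).trans ?_
    rw [← fiberTrace_sum hK hKΩ hg _ fun i _ =>
      (((hwg i).mul ((hc i).mul (hθ j))).continuousOn.mono hKΩ)]
    refine fiberTrace_congr hK fun x hx => ?_
    rw [hJ x (hKΩ hx) j, hfc x (hKΩ hx), Finset.sum_mul]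
    exact Finset.sum_congr rfl fun i _ => by ring

end Trace

end ResidueTrace

section Pullback

lemma ContinuousLinearMap.apply_eq_sum_single {ι : Type*} [Fintype ι] [DecidableEq ι]
    (L : (ι → ℂ) →L[ℂ] ℂ) (v : ι → ℂ) : L v = ∑ i, v i * L (Pi.single i 1) := by
  conv_lhs => rw [pi_eq_sum_univ' v, map_sum]
  exact Finset.sum_congr rfl fun i _ => by rw [map_smul, smul_eq_mul]

lemma exists_frequently_component_ne_zero {n : ℕ} {ω : OneForm n} {W : Set (Cn n)} (hW : W ∈ 𝓝 0)
    (hcodim : CodimAtLeastTwo {x ∈ W | ω x = 0}) {v : Cn n} (hv : v ≠ 0) :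
    ∃ i, ∃ᶠ x in 𝓝 0, ω x (Pi.single i 1) ≠ 0 := by
  by_contra! hcon
  have hev : ∀ᶠ x in 𝓝 (0 : Cn n), ∀ i, ω x (Pi.single i 1) = 0 :=
    eventually_all.mpr hcon
  obtain ⟨s, hs, hsub⟩ := Metric.nhds_basis_ball.mem_iff.mp (inter_mem hW hev)
  obtain ⟨i, hi⟩ := Function.ne_iff.mp hv
  refine hcodim ⟨0, Metric.ball 0 s, fun x => x i, Metric.isOpen_ball,
    (convex_ball 0 s).isPreconnected, Metric.mem_ball_self hs,
    fun x _ => (ContinuousLinearMap.proj (R := ℂ) (φ := fun _ : Fin n => ℂ) i).analyticAt x, rfl,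
    ⟨Pi.single i ((s / 2 : ℝ) : ℂ), ?_, ?_⟩, fun x hx => ⟨(hsub hx.1).1, ?_⟩⟩
  · rw [mem_ball_zero_iff, Pi.norm_single, Complex.norm_real, Real.norm_of_nonneg (by positivity)]
    exact half_lt_self hs
  · simpa using hs.ne'
  · ext u
    rw [ContinuousLinearMap.apply_eq_sum_single]
    simpa using Finset.sum_eq_zero fun j _ => by rw [(hsub hx.1).2 j, mul_zero]

lemma det_jacobian_mul_eq {n : ℕ} {g : Cn n → Cn n} {x : Cn n} {α β : Cn n →L[ℂ] ℂ} {b : ℂ}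
    (h : α.comp (fderiv ℂ g x) = b • β) (j : Fin n) :
    α (Pi.single j 1) * (jacobian g x).det =
      b * ∑ k, (jacobian g x).adjugate j k * β (Pi.single k 1) := by
  have hJ : (jacobian g x).mulVec (fun i => α (Pi.single i 1)) =
      b • fun k => β (Pi.single k 1) := by
    ext k
    have := DFunLike.congr_fun h (Pi.single k 1)
    rw [ContinuousLinearMap.comp_apply, ContinuousLinearMap.apply_eq_sum_single] at this
    exact this
  have hadj := congrFun (congrArg (jacobian g x).adjugate.mulVec hJ) j
  rw [Matrix.mulVec_mulVec, Matrix.adjugate_mul, Matrix.smul_mulVec, Matrix.one_mulVec,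
    Matrix.mulVec_smul] at hadj
  rw [mul_comm]
  exact hadj

end Pullback

/-- **Theorem B.** Let `g : (ℂⁿ, 0) → (ℂⁿ, 0)` be (a representative of) a germ of a
finite holomorphic map.  Let `F` be a germ of a codimension one holomorphic foliation,
defined by the one-form `ω` on `W`, that is singular at `0` (`ω 0 = 0`).  The pullback
foliation `g*F` is defined near `0` by any holomorphic one-form `η` such that
`g*ω = f • η` for a holomorphic function `f ≢ 0` and the zero locus of `η` has
codimension `≥ 2`.  Then `g*F` is singular at `0`, i.e. `η 0 = 0`. -/
theorem pullback_singular_foliation_singular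
    {n : ℕ} (g : Cn n → Cn n) (U W : Set (Cn n))
    (hUopen : IsOpen U) (hU0 : (0 : Cn n) ∈ U) (hW0 : (0 : Cn n) ∈ W)
    (hghol : AnalyticOnNhd ℂ g U) (hmaps : MapsTo g U W) (hg0 : g 0 = 0)
    (hfin : U ∩ g ⁻¹' {0} = {0})
    (ω : OneForm n) (hF : IsFoliationOn ω W) (hsing : ω 0 = 0)
    (U' : Set (Cn n)) (hU'open : IsOpen U') (hU'0 : (0 : Cn n) ∈ U') (hU'U : U' ⊆ U)
    (f : Cn n → ℂ) (η : OneForm n)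
    (hf : AnalyticOnNhd ℂ f U') (hη : AnalyticOnNhd ℂ η U')
    (hfne : ∃ x ∈ U', f x ≠ 0)
    (hfac : ∀ x ∈ U', (ω (g x)).comp (fderiv ℂ g x) = f x • η x)
    (hcodim : CodimAtLeastTwo {x ∈ U' | η x = 0}) :
    η 0 = 0 := by
  by_contra hη0
  obtain ⟨v, hv⟩ := DFunLike.ne_iff.mp hη0
  have hv0 : v ≠ 0 := fun h => hv (by simp [h])
  have hzero : ∀ x ∈ U, g x = 0 → x = 0 := fun x hx hgx => hfin.subset ⟨hx, hgx⟩
  have happ : ∀ (α : OneForm n) (V : Set (Cn n)), AnalyticOnNhd ℂ α V → ∀ u,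
      AnalyticOnNhd ℂ (fun x => α x u) V := fun α V hα u x hx =>
    ((ContinuousLinearMap.apply ℂ ℂ u).analyticAt _).comp (hα x hx)
  have hgc : ContinuousAt g 0 := (hghol 0 hU0).continuousAt
  obtain ⟨ρ, hρ, hρW⟩ := Metric.nhds_basis_ball.mem_iff.mp (hF.isOpen.mem_nhds hW0)
  have hR : 0 < ρ / 5 := by positivity
  have hsmall : U' ∩ {x | η x v ≠ 0} ∩ g ⁻¹' Metric.ball 0 (ρ / 5) ∈ 𝓝 (0 : Cn n) := by
    refine inter_mem (inter_mem (hU'open.mem_nhds hU'0)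
      ((happ η U' hη v 0 hU'0).continuousAt.eventually_ne hv))
      (hgc.preimage_mem_nhds ?_)
    rw [hg0]
    exact Metric.ball_mem_nhds 0 hR
  obtain ⟨r, hr, hrs⟩ := Metric.nhds_basis_ball.mem_iff.mp hsmall
  have hΩU : Metric.ball 0 r ⊆ U' := fun x hx => (hrs hx).1.1
  have hg : AnalyticOnNhd ℂ g (Metric.ball 0 r) := hghol.mono (hΩU.trans hU'U)
  have hK : IsCompact (Metric.closedBall (0 : Cn n) (r / 2)) := isCompact_closedBall _ _
  have hKΩ : Metric.closedBall (0 : Cn n) (r / 2) ⊆ Metric.ball 0 r :=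
    Metric.closedBall_subset_ball (half_lt_self hr)
  have hfront : ∀ x ∈ frontier (Metric.closedBall (0 : Cn n) (r / 2)), g x ≠ 0 := by
    intro x hx hgx
    have hxK := hK.isClosed.frontier_subset hx
    rw [hzero x (hU'U (hΩU (hKΩ hxK))) hgx] at hx
    exact hx.2 (mem_interior_iff_mem_nhds.mpr (Metric.closedBall_mem_nhds 0 (half_pos hr)))
  obtain ⟨a, ha, hlt⟩ := exists_pos_forall_frontier_lt_normSqSum hK (hg.continuousOn.mono hKΩ)
    hfront
  have hltev : ∀ᶠ y in 𝓝 (0 : Cn n), ∀ x ∈ frontier (Metric.closedBall (0 : Cn n) (r / 2)),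
      a < normSqSum (g x - y) := by
    refine (hK.of_isClosed_subset isClosed_frontier
      hK.isClosed.frontier_subset).eventually_forall_of_forall_eventually
      (P := fun y x => a < normSqSum (g x - y)) fun x hx => ?_
    have hgx : ContinuousAt g x := (hg x (hKΩ (hK.isClosed.frontier_subset hx))).continuousAt
    have h1 : ContinuousAt (fun p : Cn n × Cn n => normSqSum (g p.2 - p.1)) (0, x) :=
      continuous_normSqSum.continuousAt.comp
        ((ContinuousAt.comp (g := g) hgx continuousAt_snd).sub continuousAt_fst)
    exact h1.eventually (lt_mem_nhds (by simpa using hlt x hx))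
  have hwzero : ∀ x, (fun i => ω x (Pi.single i 1)) = 0 ↔ ω x = 0 := fun x =>
    ⟨fun h => by
      ext u
      rw [ContinuousLinearMap.apply_eq_sum_single]
      simpa using Finset.sum_eq_zero fun j _ => by
        rw [show ω x (Pi.single j 1) = 0 from congrFun h j, mul_zero],
    fun h => by simp [h, funext_iff]⟩
  have htrace := fiberTrace_jacobian_det_eq_zero (a := a) Metric.isOpen_ball
    (convex_ball (0 : Cn n) r).isPreconnected hg hK hKΩ hltev hR (fun x hx => (hrs hx).2) hF.isOpen
    (by rwa [mul_div_cancel₀ ρ (show (5 : ℝ) ≠ 0 by norm_num)])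
    (w := fun i x => ω x (Pi.single i 1))
    (fun i => happ ω W hF.holo _) (fun i => by simp [hsing])
    (exists_frequently_component_ne_zero (hF.isOpen.mem_nhds hW0) hF.codim hv0)
    (by simp only [hwzero]; exact hF.codim) (hf.mono hΩU)
    (θ := fun j x => ∑ k, (jacobian g x).adjugate j k * η x (Pi.single k 1))
    (c := fun i x => fderiv ℂ g x v i / η x v)
    (fun j x hx => Finset.analyticAt_fun_sum _ fun k _ =>
      ((hg x hx).jacobian_adjugate j k).mul (happ η U' hη _ x (hΩU hx)))
    (fun i x hx => ((hg x hx).fderiv_apply_apply v i).div (happ η U' hη v x (hΩU hx))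
      (hrs hx).1.2)
    (fun x hx j => det_jacobian_mul_eq (hfac x (hΩU hx)) j)
    (fun x hx => ?_)
  · refine integral_cutoff_mul_jacobian_ne_zero (a := a) hK hKΩ hg 2 ?_
      (by simpa [fiberTrace] using htrace)
    have hsq : ContinuousAt (fun x => normSqSum (g x)) 0 :=
      ContinuousAt.comp (g := normSqSum) continuous_normSqSum.continuousAt hgc
    have h1 : ∀ᶠ x in 𝓝 (0 : Cn n), normSqSum (g x) < a :=
      hsq.eventually (gt_mem_nhds (by simpa only [hg0, normSqSum_eq_zero.mpr rfl] using ha))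
    have h2 := interior_mem_nhds.mpr (Metric.closedBall_mem_nhds (0 : Cn n) (half_pos hr))
    obtain ⟨x, hx, hxa, hxK⟩ := ((frequently_jacobian_det_ne_zero hUopen hU0 hghol hg0
      hzero).and_eventually (h1.and h2)).exists
    exact ⟨x, hxK, hxa, hx⟩
  · have h1 := DFunLike.congr_fun (hfac x (hΩU hx)) v
    rw [ContinuousLinearMap.comp_apply, ContinuousLinearMap.apply_eq_sum_single] at h1
    have h2 : η x v ≠ 0 := (hrs hx).1.2
    rw [← mul_div_cancel_right₀ (f x) h2]
    simp only [mul_div_assoc']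
    rw [← Finset.sum_div]
    congr 1
    rw [show f x * η x v = (f x • η x) v from rfl, ← h1]
    exact Finset.sum_congr rfl fun i _ => mul_comm _ _
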